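/- arXiv:2102.07622 — 9 statements merged into one kernel-verified Lean document; each statement's English description precedes it below -/
import Mathlib

section
/- Let W be a finite set of rationals contained in [0,1] with 0 ∈ W and |W| = k ≥ 2, and let ℓ be the least common multiple of the denominators of the elements of W. Let ν ≥ 1, let A ⊆ W^ν, and let Q be a finite set of queries over ν variables such that every query of Q has width at least w (for some integer w ≥ 1) and the slabs of the queries in Q cover A. Then |A| ≤ |Q| · ℓ · k^ν / √w. -/
open Finset in
theorem aux_central (m : ℕ) : (3 * m + 1) * (Nat.centralBinom m) ^ 2 ≤ 16 ^ m := by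
  induction m with
  | zero => simp
  | succ m ih =>
    have h := Nat.succ_mul_centralBinom_succ m
    set x := Nat.centralBinom m
    set y := Nat.centralBinom (m + 1)
    have h2 : (m + 1) ^ 2 * y ^ 2 = 4 * (2 * m + 1) ^ 2 * x ^ 2 := by
      calc (m + 1) ^ 2 * y ^ 2 = ((m + 1) * y) ^ 2 := by ring
        _ = _ := by rw [h]; ring
    have h3 : (3 * m + 4) * (2 * m + 1) ^ 2 ≤ 4 * (3 * m + 1) * (m + 1) ^ 2 := by
      nlinarith
    have h4 : (m + 1) ^ 2 * ((3 * (m + 1) + 1) * y ^ 2) ≤ (m + 1) ^ 2 * 16 ^ (m + 1) := by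
      calc (m + 1) ^ 2 * ((3 * (m + 1) + 1) * y ^ 2)
          = (3 * m + 4) * ((m + 1) ^ 2 * y ^ 2) := by ring
        _ = 4 * ((3 * m + 4) * (2 * m + 1) ^ 2) * x ^ 2 := by rw [h2]; ring
        _ ≤ 4 * (4 * (3 * m + 1) * (m + 1) ^ 2) * x ^ 2 := by gcongr
        _ = 16 * (m + 1) ^ 2 * ((3 * m + 1) * x ^ 2) := by ring
        _ ≤ 16 * (m + 1) ^ 2 * 16 ^ m := by gcongr
        _ = _ := by ring
    exact Nat.le_of_mul_le_mul_left h4 (by positivity)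

theorem aux_choose (n : ℕ) : n * (n.choose (n / 2)) ^ 2 ≤ 4 ^ n := by
  rcases Nat.even_or_odd' n with ⟨m, rfl | rfl⟩
  · have h := aux_central m
    rw [Nat.centralBinom_eq_two_mul_choose] at h
    have e : 2 * m / 2 = m := by omega
    rw [e, pow_mul]
    norm_num
    nlinarith [sq_nonneg ((2 * m).choose m)]
  · have h := aux_central (m + 1)
    rw [Nat.centralBinom_eq_two_mul_choose] at h
    have e : (2 * m + 1) / 2 = m := by omega
    have e2 : (2 * (m + 1)).choose (m + 1) = 2 * (2 * m + 1).choose m := by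
      have := Nat.choose_succ_succ (2 * m + 1) m
      have h3 := Nat.choose_symm_half m
      simp only [Nat.succ_eq_add_one] at this
      rw [show 2 * (m + 1) = 2 * m + 1 + 1 by ring, this, h3]; ring
    rw [e2] at h
    rw [e]
    have e4 : (4 : ℕ) ^ (2 * m + 1) = 4 * 16 ^ m := by
      rw [pow_succ, pow_mul]; norm_num; ring
    rw [e4]
    rw [pow_succ 16 m] at h
    nlinarith [sq_nonneg ((2 * m + 1).choose m)]

open Finset in
theorem aux_LO {ι : Type*} [Fintype ι] [DecidableEq ι] (c : ι → ℚ) (hc : ∀ i, c i ≠ 0) (v : ℚ) :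
    (univ.filter fun T : Finset ι => ∑ i ∈ T, c i = v).card
      ≤ (Fintype.card ι).choose (Fintype.card ι / 2) := by
  classical
  set N : Finset ι := univ.filter fun i => c i < 0 with hN
  have key : ∀ T : Finset ι, ∑ i ∈ symmDiff T N, |c i| = ∑ i ∈ T, c i - ∑ i ∈ N, c i := by
    intro T
    rw [← Fintype.sum_ite_mem, ← Fintype.sum_ite_mem T, ← Fintype.sum_ite_mem N,
      ← Finset.sum_sub_distrib]
    refine Finset.sum_congr rfl fun i _ => ?_
    by_cases h1 : i ∈ T <;> by_cases h2 : c i < 0 <;>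
      simp [Finset.mem_symmDiff, hN, h1, h2, abs_of_neg, abs_of_nonneg, not_lt.mp]
  have hinj : Function.Injective (fun T : Finset ι => symmDiff T N) := symmDiff_left_injective N
  rw [← Finset.card_image_of_injective _ hinj]
  apply IsAntichain.sperner
  intro X hX Y hY hne hle
  simp only [Finset.coe_image, Set.mem_image, Finset.mem_coe, Finset.mem_filter,
    Finset.mem_univ, true_and] at hX hY
  obtain ⟨T, hT, rfl⟩ := hX
  obtain ⟨U, hU, rfl⟩ := hY
  have hss : symmDiff T N ⊂ symmDiff U N := Finset.ssubset_iff_subset_ne.mpr ⟨hle, hne⟩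
  obtain ⟨j, hj, hj'⟩ := Finset.exists_of_ssubset hss
  have := Finset.sum_lt_sum_of_subset (f := fun i => |c i|) hle hj hj'
    (abs_pos.mpr (hc j)) (fun i _ _ => abs_nonneg _)
  simp only [key, hT, hU, lt_irrefl] at this

open Finset in
theorem aux_hyper (W : Finset ℚ) (hk2 : 2 ≤ W.card) (ν : ℕ) (a : Fin ν → ℤ) (v : ℚ) (w : ℕ)
    (hw : w ≤ (Finset.univ.filter fun i => a i ≠ 0).card) :
    ((univ.filter fun s : Fin ν → W => ∑ i, (a i : ℚ) * (s i : ℚ) = v).card : ℝ) * Real.sqrt w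
      ≤ (W.card : ℝ) ^ ν := by
  classical
  set S := Finset.univ.filter fun i => a i ≠ 0 with hS
  obtain ⟨σ, hσ⟩ : ∃ σ : Equiv.Perm W, ∀ x, σ x ≠ x := by
    obtain ⟨σ, h, -⟩ := Finset.exists_cycleOn (Finset.univ : Finset W)
    refine ⟨σ, fun x => h.apply_ne ?_ (by simp)⟩
    have : 1 < Fintype.card W := by rw [Fintype.card_coe]; omega
    have := Fintype.one_lt_card_iff_nontrivial.mp this
    simpa using Set.nontrivial_univ
  let F : Finset S → Equiv.Perm (Fin ν → W) := fun T =>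
    Equiv.piCongrRight fun i => if i ∈ T.map (Function.Embedding.subtype _) then σ else Equiv.refl _
  set H := univ.filter fun s : Fin ν → W => ∑ i, (a i : ℚ) * (s i : ℚ) = v with hH
  have hF : ∀ (T : Finset S) (s : Fin ν → W), ∑ i, (a i : ℚ) * (F T s i : ℚ) =
      ∑ i, (a i : ℚ) * (s i : ℚ) + ∑ i ∈ T, (a i : ℚ) * ((σ (s i) : ℚ) - s i) := by
    intro T s
    have : ∑ i ∈ T, (a i : ℚ) * ((σ (s i) : ℚ) - s i) =
      ∑ i ∈ T.map (Function.Embedding.subtype _), (a i : ℚ) * ((σ (s i) : ℚ) - s i) := by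
      rw [Finset.sum_map]; rfl
    rw [this, ← Fintype.sum_ite_mem (Finset.map _ _), ← Finset.sum_add_distrib]
    refine Finset.sum_congr rfl fun i _ => ?_
    simp only [F, Equiv.piCongrRight_apply, Pi.map_apply]
    split_ifs
    · ring
    · simp
  have hcard : ∀ T : Finset S, (univ.filter fun s => F T s ∈ H).card = H.card := by
    intro T
    rw [← Finset.card_map (F T).toEmbedding]
    congr 1
    ext s
    simp only [Finset.mem_map, Finset.mem_filter, Finset.mem_univ, true_and,
      Equiv.coe_toEmbedding]
    constructor
    · rintro ⟨t, ht, rfl⟩; exact ht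
    · intro h; exact ⟨(F T).symm s, by simpa using h, by simp⟩
  have hdouble : 2 ^ S.card * H.card ≤ W.card ^ ν * (S.card).choose (S.card / 2) := by
    calc 2 ^ S.card * H.card = ∑ T : Finset S, (univ.filter fun s => F T s ∈ H).card := by
          simp [hcard]
      _ = ∑ s : Fin ν → W, (univ.filter fun T => F T s ∈ H).card := by
          simp only [Finset.card_filter]
          exact Finset.sum_comm
      _ ≤ ∑ s : Fin ν → W, (S.card).choose (S.card / 2) := by
          refine Finset.sum_le_sum fun s _ => ?_
          have := aux_LO (ι := S) (fun i => (a i : ℚ) * ((σ (s i) : ℚ) - s i)) (by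
            intro i
            have h1 : a i ≠ 0 := (Finset.mem_filter.mp i.2).2
            have h2 : (σ (s i) : ℚ) ≠ s i := fun h => hσ _ (Subtype.ext h)
            exact mul_ne_zero (by exact_mod_cast h1) (sub_ne_zero.mpr h2))
            (v - ∑ i, (a i : ℚ) * (s i : ℚ))
          rw [Fintype.card_coe] at this
          refine le_trans (Finset.card_le_card ?_) this
          intro T hT
          simp only [hH, Finset.mem_filter, Finset.mem_univ, true_and, hF] at hT ⊢
          linarith
      _ = _ := by simp
  have hch := aux_choose S.card
  set n := S.card
  set C := n.choose (n / 2)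
  have hC : Real.sqrt w * C ≤ 2 ^ n := by
    have : Real.sqrt w * C = Real.sqrt (w * C ^ 2) := by
      rw [Real.sqrt_mul (by positivity), Real.sqrt_sq (by positivity)]
    rw [this]
    apply Real.sqrt_le_iff.mpr ⟨by positivity, ?_⟩
    have h1 : w * C ^ 2 ≤ 4 ^ n := le_trans (Nat.mul_le_mul_right _ hw) hch
    have h2 : ((2 : ℝ) ^ n) ^ 2 = 4 ^ n := by rw [← pow_mul, mul_comm, pow_mul]; norm_num
    rw [h2]
    exact_mod_cast h1
  have hd : (2 : ℝ) ^ n * H.card ≤ (W.card : ℝ) ^ ν * C := by exact_mod_cast hdouble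
  have h2 : (0 : ℝ) < 2 ^ n := by positivity
  refine le_of_mul_le_mul_left ?_ h2
  calc (2 : ℝ) ^ n * (H.card * Real.sqrt w) = (2 ^ n * H.card) * Real.sqrt w := by ring
    _ ≤ ((W.card : ℝ) ^ ν * C) * Real.sqrt w := by gcongr
    _ = (W.card : ℝ) ^ ν * (Real.sqrt w * C) := by ring
    _ ≤ (W.card : ℝ) ^ ν * 2 ^ n := by gcongr
    _ = _ := by ring

open Finset in
theorem aux_slab (W : Finset ℚ) (hk2 : 2 ≤ W.card) (l : ℕ)
    (hl : l = W.lcm (fun s => (s.den : ℕ))) (ν : ℕ) (a : Fin ν → ℤ) (b : ℤ) (w : ℕ)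
    (hw : w ≤ (Finset.univ.filter fun i => a i ≠ 0).card) :
    ((univ.filter fun s : Fin ν → W => (b : ℚ) - 1 < ∑ i, (a i : ℚ) * (s i : ℚ) ∧
      ∑ i, (a i : ℚ) * (s i : ℚ) < b).card : ℝ) * Real.sqrt w
      ≤ l * (W.card : ℝ) ^ ν := by
  classical
  have hl0 : 0 < l := by
    rw [hl, Nat.pos_iff_ne_zero, Ne, Finset.lcm_eq_zero_iff]
    simp
  have hlq : (0 : ℚ) < l := by exact_mod_cast hl0
  have hint : ∀ s : W, ∃ m : ℤ, (l : ℚ) * s = m := by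
    intro s
    have hd : (s : ℚ).den ∣ l := by rw [hl]; exact Finset.dvd_lcm s.2
    obtain ⟨t, ht⟩ := hd
    refine ⟨t * (s : ℚ).num, ?_⟩
    have := Rat.mul_den_eq_num (s : ℚ)
    rw [ht]; push_cast
    rw [← this]; ring
  choose f hf using hint
  set P := univ.filter fun s : Fin ν → W => (b : ℚ) - 1 < ∑ i, (a i : ℚ) * (s i : ℚ) ∧
      ∑ i, (a i : ℚ) * (s i : ℚ) < b with hP
  have hsub : P ⊆ (Finset.Ioo ((l : ℤ) * (b - 1)) (l * b)).biUnion fun m =>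
      univ.filter fun s : Fin ν → W => ∑ i, (a i : ℚ) * (s i : ℚ) = m / l := by
    intro s hs
    simp only [hP, Finset.mem_filter, Finset.mem_univ, true_and] at hs
    simp only [Finset.mem_biUnion, Finset.mem_filter, Finset.mem_univ, true_and, Finset.mem_Ioo]
    have he : (l : ℚ) * ∑ i, (a i : ℚ) * (s i : ℚ) = ((∑ i, a i * f (s i) : ℤ) : ℚ) := by
      push_cast
      rw [Finset.mul_sum]
      refine Finset.sum_congr rfl fun i _ => ?_
      rw [← hf]; ring
    refine ⟨∑ i, a i * f (s i), ⟨?_, ?_⟩, ?_⟩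
    · have : (l : ℚ) * (b - 1) < ((∑ i, a i * f (s i) : ℤ) : ℚ) := by
        rw [← he]; exact mul_lt_mul_of_pos_left hs.1 hlq
      exact_mod_cast this
    · have : ((∑ i, a i * f (s i) : ℤ) : ℚ) < (l : ℚ) * b := by
        rw [← he]; exact mul_lt_mul_of_pos_left hs.2 hlq
      exact_mod_cast this
    · rw [← he]; field_simp
  have hcI : (Finset.Ioo ((l : ℤ) * (b - 1)) (l * b)).card ≤ l := by
    rw [Int.card_Ioo]
    have : (l : ℤ) * b - l * (b - 1) - 1 = l - 1 := by ring
    rw [this]; omega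
  have h1 : (P.card : ℝ) ≤ ∑ m ∈ Finset.Ioo ((l : ℤ) * (b - 1)) (l * b),
      ((univ.filter fun s : Fin ν → W => ∑ i, (a i : ℚ) * (s i : ℚ) = m / l).card : ℝ) := by
    exact_mod_cast (Finset.card_le_card hsub).trans Finset.card_biUnion_le
  calc (P.card : ℝ) * Real.sqrt w ≤ _ := mul_le_mul_of_nonneg_right h1 (Real.sqrt_nonneg _)
    _ ≤ ∑ m ∈ Finset.Ioo ((l : ℤ) * (b - 1)) (l * b), (W.card : ℝ) ^ ν := by
      rw [Finset.sum_mul]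
      exact Finset.sum_le_sum fun m _ => aux_hyper W hk2 ν a _ w hw
    _ = ((Finset.Ioo ((l : ℤ) * (b - 1)) (l * b)).card : ℝ) * (W.card : ℝ) ^ ν := by
      rw [Finset.sum_const, nsmul_eq_mul]
    _ ≤ l * (W.card : ℝ) ^ ν := by gcongr


/-- antichain-method counting bound.
A query over `Fin ν` is a pair `(a, b)` with `a : Fin ν → ℤ`, `b : ℤ`; its slab is
`{x : Fin ν → ℝ | b - 1 < ∑ i, a i * x i < b}`.  If every query of `Q` has width at
least `w ≥ 1` and the slabs of `Q` cover `A ⊆ W^ν`, then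
`|A| ≤ |Q| · ℓ · k^ν / √w`, where `k = |W|` and `ℓ` is the lcm of the denominators
of the elements of `W`. -/
theorem statement_0
    (W : Finset ℚ) (hW0 : (0 : ℚ) ∈ W) (hWrange : ∀ s ∈ W, 0 ≤ s ∧ s ≤ 1)
    (k : ℕ) (hk : W.card = k) (hk2 : 2 ≤ k)
    (l : ℕ) (hl : l = W.lcm (fun s => (s.den : ℕ)))
    (ν : ℕ) (hν : 1 ≤ ν)
    (A : Finset (Fin ν → ℚ)) (hA : ∀ x ∈ A, ∀ i, x i ∈ W)
    (w : ℕ) (hw : 1 ≤ w)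
    (Q : Finset ((Fin ν → ℤ) × ℤ))
    (hwidth : ∀ a ∈ Q, w ≤ (Finset.univ.filter fun i => a.1 i ≠ 0).card)
    (hcover : ∀ x ∈ A, ∃ a ∈ Q,
      (a.2 : ℝ) - 1 < ∑ i, (a.1 i : ℝ) * (x i : ℝ) ∧
        ∑ i, (a.1 i : ℝ) * (x i : ℝ) < (a.2 : ℝ)) :
    (A.card : ℝ) ≤ (Q.card : ℝ) * l * (k : ℝ) ^ ν / Real.sqrt w := by

  classical
  subst hk
  have hsw : 0 < Real.sqrt w := Real.sqrt_pos.mpr (by exact_mod_cast hw)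
  rw [le_div_iff₀ hsw]
  let P : (Fin ν → ℤ) × ℤ → Finset (Fin ν → W) := fun q =>
    Finset.univ.filter fun s : Fin ν → W => (q.2 : ℚ) - 1 < ∑ i, (q.1 i : ℚ) * (s i : ℚ) ∧
      ∑ i, (q.1 i : ℚ) * (s i : ℚ) < q.2
  have hsub : A ⊆ (Q.biUnion P).image (fun s i => (s i : ℚ)) := by
    intro x hx
    obtain ⟨q, hq, h1, h2⟩ := hcover x hx
    refine Finset.mem_image.mpr ⟨fun i => ⟨x i, hA x hx i⟩, ?_, rfl⟩
    refine Finset.mem_biUnion.mpr ⟨q, hq, ?_⟩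
    simp only [P, Finset.mem_filter, Finset.mem_univ, true_and]
    exact ⟨by exact_mod_cast h1, by exact_mod_cast h2⟩
  have hc : (A.card : ℝ) ≤ ∑ q ∈ Q, ((P q).card : ℝ) := by
    exact_mod_cast (Finset.card_le_card hsub).trans
      (Finset.card_image_le.trans Finset.card_biUnion_le)
  calc (A.card : ℝ) * Real.sqrt w ≤ (∑ q ∈ Q, ((P q).card : ℝ)) * Real.sqrt w := by gcongr
    _ ≤ ∑ q ∈ Q, (l * (W.card : ℝ) ^ ν) := by
      rw [Finset.sum_mul]
      exact Finset.sum_le_sum fun q hq => aux_slab W hk2 l hl ν q.1 q.2 w (hwidth q hq)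
    _ = _ := by rw [Finset.sum_const, nsmul_eq_mul]; ring
end

section
/- For all integers t ≥ 2 and f ≥ 1, every antichain in the poset [t]^f (the set of f-tuples with entries in {1,…,t}, ordered pointwise) has size at most t^f/√f. -/
lemma cb_bound (m : ℕ) : m.centralBinom ^ 2 * (2 * m + 1) ≤ 16 ^ m := by
  induction m with
  | zero => simp
  | succ m ih =>
    have h := Nat.succ_mul_centralBinom_succ m
    set C := m.centralBinom
    set D := (m + 1).centralBinom
    have h2 : (m + 1) ^ 2 * (D ^ 2 * (2 * (m + 1) + 1)) ≤ (m + 1) ^ 2 * 16 ^ (m + 1) := by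
      calc (m + 1) ^ 2 * (D ^ 2 * (2 * (m + 1) + 1))
          = ((m + 1) * D) ^ 2 * (2 * m + 3) := by ring
        _ = (C ^ 2 * (2 * m + 1)) * (4 * ((2 * m + 1) * (2 * m + 3))) := by rw [h]; ring
        _ ≤ 16 ^ m * (16 * (m + 1) ^ 2) := Nat.mul_le_mul ih (by nlinarith)
        _ = _ := by ring
    exact Nat.le_of_mul_le_mul_left h2 (by positivity)

lemma choose_bound (f : ℕ) : (f.choose (f / 2)) ^ 2 * f ≤ 4 ^ f := by
  obtain ⟨m, rfl | rfl⟩ := Nat.even_or_odd' f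
  · have h := cb_bound m
    rw [Nat.centralBinom_eq_two_mul_choose] at h
    rw [show 2 * m / 2 = m by omega, pow_mul]
    norm_num
    nlinarith
  · have h := cb_bound (m + 1)
    have e : (m + 1).centralBinom = 2 * (2 * m + 1).choose m := by
      rw [Nat.centralBinom_eq_two_mul_choose, show 2 * (m + 1) = (2 * m + 1) + 1 by ring,
        Nat.choose_succ_succ, Nat.choose_symm_half]
      ring
    rw [e] at h
    rw [show (2 * m + 1) / 2 = m by omega, pow_succ 4, pow_mul]
    norm_num
    rw [pow_succ 16] at h
    nlinarith

/-- The corner of the cyclic cube based at `g`. -/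
def corner {n f : ℕ} (g : Fin f → Fin (n + 2)) (S : Finset (Fin f)) : Fin f → Fin (n + 2) :=
  fun i => if i ∈ S then g i + 1 else g i

lemma corner_inj {n f : ℕ} (g : Fin f → Fin (n + 2)) : Function.Injective (corner g) := by
  intro S T h
  ext i
  have := congrFun h i
  have h1 : g i + 1 ≠ g i := by simp
  by_cases hS : i ∈ S <;> by_cases hT : i ∈ T <;> simp_all [corner]

lemma fiber_bound {n f : ℕ} (A : Finset (Fin f → Fin (n + 2)))
    (hA : IsAntichain (· ≤ ·) (A : Set (Fin f → Fin (n + 2)))) (g : Fin f → Fin (n + 2)) :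
    (Finset.univ.filter fun S => corner g S ∈ A).card ≤ f.choose (f / 2) := by
  classical
  set W : Finset (Fin f) := Finset.univ.filter fun i => g i + 1 ≤ g i with hW
  have hinj : Function.Injective (fun S : Finset (Fin f) => symmDiff S W) :=
    symmDiff_left_injective W
  rw [← Finset.card_image_of_injective _ hinj]
  have := IsAntichain.sperner (𝒜 := (Finset.univ.filter fun S => corner g S ∈ A).image
    (fun S : Finset (Fin f) => symmDiff S W)) ?_
  · simpa using this
  · intro X hX Y hY hne hle
    simp only [Finset.coe_image, Finset.coe_filter, Finset.mem_univ, true_and, Set.mem_image,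
      Set.mem_ofPred_eq] at hX hY
    obtain ⟨S, hS, rfl⟩ := hX
    obtain ⟨T, hT, rfl⟩ := hY
    have hST : S ≠ T := fun h => hne (by rw [h])
    refine hA hS hT (fun h => hST (corner_inj g h)) ?_
    intro i
    have hi := @hle i
    simp only [Finset.mem_symmDiff, hW, Finset.mem_filter, Finset.mem_univ, true_and] at hi
    have h2 := le_total (g i + 1) (g i)
    by_cases h1 : i ∈ S <;> by_cases h3 : i ∈ T <;> simp only [corner, h1, h3, if_true, if_false] <;>
      simp_all

lemma col_count {n f : ℕ} (A : Finset (Fin f → Fin (n + 2))) (S : Finset (Fin f)) :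
    (Finset.univ.filter fun g => corner g S ∈ A).card = A.card := by
  classical
  refine Finset.card_bij (fun g _ => corner g S) (by simp) ?_ ?_
  · intro a _ b _ h
    ext1 i
    have := congrFun h i
    by_cases hS : i ∈ S <;> simpa [corner, hS] using this
  · intro b hb
    have : corner (fun i => if i ∈ S then b i - 1 else b i) S = b := by
      ext1 i
      by_cases hS : i ∈ S <;> simp [corner, hS]
    exact ⟨_, by simpa [this] using hb, this⟩

lemma main_count {n f : ℕ} (A : Finset (Fin f → Fin (n + 2)))
    (hA : IsAntichain (· ≤ ·) (A : Set (Fin f → Fin (n + 2)))) :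
    2 ^ f * A.card ≤ (n + 2) ^ f * f.choose (f / 2) := by
  classical
  have h := Finset.sum_card_bipartiteAbove_eq_sum_card_bipartiteBelow
    (s := (Finset.univ : Finset (Fin f → Fin (n + 2))))
    (t := (Finset.univ : Finset (Finset (Fin f)))) (fun g S => corner g S ∈ A)
  simp only [Finset.bipartiteAbove, Finset.bipartiteBelow, col_count] at h
  have h2 := Finset.sum_le_sum (s := (Finset.univ : Finset (Fin f → Fin (n + 2))))
    (fun g _ => fiber_bound A hA g)
  rw [h] at h2
  simpa using h2

/-- Sperner-type bound: for integers `t ≥ 2` and `f ≥ 1`, every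
antichain in `[t]^f` (functions `Fin f → Fin t` with the pointwise order) has
size at most `t^f / √f`. -/
theorem statement_1 (t f : ℕ) (ht : 2 ≤ t) (hf : 1 ≤ f)
    (A : Finset (Fin f → Fin t))
    (hA : IsAntichain (· ≤ ·) (A : Set (Fin f → Fin t))) :
    (A.card : ℝ) ≤ (t : ℝ) ^ f / Real.sqrt f := by
  obtain ⟨n, rfl⟩ := Nat.exists_eq_add_of_le' ht
  have h1 := main_count A hA
  have h2 := choose_bound f
  have hf' : (0 : ℝ) < f := by exact_mod_cast hf
  rw [le_div_iff₀ (Real.sqrt_pos.2 hf')]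
  have h3 : (f.choose (f / 2) : ℝ) * Real.sqrt f ≤ 2 ^ f := by
    refine (pow_le_pow_iff_left₀ (by positivity) (by positivity) (two_ne_zero)).1 ?_
    rw [mul_pow, Real.sq_sqrt hf'.le, ← pow_mul, mul_comm f 2, pow_mul]
    norm_num
    exact_mod_cast h2
  have h4 : (2 : ℝ) ^ f * A.card ≤ ((n + 2 : ℕ) : ℝ) ^ f * (f.choose (f / 2) : ℝ) := by
    exact_mod_cast h1
  have h5 : (2 : ℝ) ^ f * (A.card * Real.sqrt f) ≤ 2 ^ f * ((n + 2 : ℕ) : ℝ) ^ f := by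
    calc (2 : ℝ) ^ f * (A.card * Real.sqrt f) = (2 ^ f * A.card) * Real.sqrt f := by ring
      _ ≤ (((n + 2 : ℕ) : ℝ) ^ f * (f.choose (f / 2) : ℝ)) * Real.sqrt f := by gcongr
      _ = ((n + 2 : ℕ) : ℝ) ^ f * ((f.choose (f / 2) : ℝ) * Real.sqrt f) := by ring
      _ ≤ ((n + 2 : ℕ) : ℝ) ^ f * 2 ^ f := by gcongr
      _ = _ := by ring
  exact le_of_mul_le_mul_left h5 (by positivity)
end

section
/- Let W be a finite set of rationals contained in [0,1] with 0 ∈ W and |W| = k ≥ 2. Let a ∈ ℤ^n be a nonzero integer vector of width w(a) (its number of nonzero coordinates), and let b ∈ ℚ. Then the number of points s ∈ W^n satisfying ∑_{i=1}^n a_i s_i = b is at most k^n/√(w(a)). -/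
open Finset in
lemma lo_aux {ι : Type} [Fintype ι] [DecidableEq ι] (d : ι → ℚ) (hd : ∀ i, d i ≠ 0) (c : ℚ) :
    (univ.filter fun T : Finset ι => ∑ i ∈ T, d i = c).card
      ≤ (Fintype.card ι).choose (Fintype.card ι / 2) := by
  classical
  set M : Finset ι := univ.filter fun i => d i < 0 with hM
  have key : ∀ T : Finset ι, ∑ i ∈ symmDiff T M, |d i| = ∑ i ∈ T, d i + ∑ i ∈ M, |d i| := by
    intro T
    have e : ∀ (S : Finset ι) (f : ι → ℚ), ∑ i ∈ S, f i = ∑ i, if i ∈ S then f i else 0 := by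
      intro S f; simp
    rw [e, e T, e M, ← Finset.sum_add_distrib]
    refine Finset.sum_congr rfl fun i _ => ?_
    by_cases hT : i ∈ T <;> by_cases hN : d i < 0
    · simp [Finset.mem_symmDiff, hM, hT, hN, abs_of_neg hN]
    · simp [Finset.mem_symmDiff, hM, hT, hN, abs_of_nonneg (not_lt.1 hN)]
    · simp [Finset.mem_symmDiff, hM, hT, hN]
    · simp [Finset.mem_symmDiff, hM, hT, hN]
  have hinj : Function.Injective (fun T : Finset ι => symmDiff T M) :=
    symmDiff_left_injective M
  rw [← Finset.card_image_of_injective _ hinj]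
  apply IsAntichain.sperner
  intro A hA B hB hne hle
  simp only [coe_image, Set.mem_image, mem_coe, mem_filter, mem_univ, true_and] at hA hB
  obtain ⟨S, hS, rfl⟩ := hA
  obtain ⟨T, hT, rfl⟩ := hB
  have hss : symmDiff S M ⊂ symmDiff T M := lt_of_le_of_ne hle hne
  obtain ⟨i, hi, hi'⟩ := Finset.exists_of_ssubset hss
  have := Finset.sum_lt_sum_of_subset hle hi hi' (abs_pos.2 (hd i)) (fun j _ _ => abs_nonneg (d j))
  rw [key, key, hS, hT] at this
  exact lt_irrefl _ this

lemma central_aux (m : ℕ) : (2 * m + 1) * (Nat.centralBinom m) ^ 2 ≤ 16 ^ m := by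
  induction m with
  | zero => simp
  | succ m ih =>
    have h := Nat.succ_mul_centralBinom_succ m
    set x := Nat.centralBinom (m + 1)
    set y := Nat.centralBinom m
    have h2 : (m + 1) ^ 2 * ((2 * (m + 1) + 1) * x ^ 2) ≤ (m + 1) ^ 2 * 16 ^ (m + 1) := by
      calc (m + 1) ^ 2 * ((2 * (m + 1) + 1) * x ^ 2) = (2 * m + 3) * ((m + 1) * x) ^ 2 := by ring
        _ = 4 * ((2 * m + 3) * (2 * m + 1)) * ((2 * m + 1) * y ^ 2) := by rw [h]; ring
        _ ≤ 4 * (4 * (m + 1) ^ 2) * 16 ^ m := by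
          exact Nat.mul_le_mul (Nat.mul_le_mul_left _ (by nlinarith)) ih
        _ = _ := by ring
    exact Nat.le_of_mul_le_mul_left h2 (by positivity)

lemma choose_aux (w : ℕ) : w * (w.choose (w / 2)) ^ 2 ≤ 4 ^ w := by
  obtain ⟨m, rfl | rfl⟩ := Nat.even_or_odd' w
  · have := central_aux m
    rw [Nat.centralBinom_eq_two_mul_choose] at this
    rw [Nat.mul_div_cancel_left _ (by norm_num), pow_mul]
    norm_num
    nlinarith
  · have := central_aux (m + 1)
    have h2 : Nat.centralBinom (m + 1) = 2 * (2 * m + 1).choose m := by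
      rw [Nat.centralBinom_eq_two_mul_choose, show 2 * (m + 1) = (2 * m + 1) + 1 by ring,
        Nat.choose_succ_succ, ← Nat.choose_symm_half m]
      ring
    rw [h2] at this
    have h3 : (2 * m + 1) / 2 = m := by omega
    rw [h3, pow_succ 4, pow_mul]
    norm_num
    rw [pow_succ 16] at this
    nlinarith

lemma exists_fpf {V : Type} [Fintype V] (h : 2 ≤ Fintype.card V) :
    ∃ σ : Equiv.Perm V, ∀ v, σ v ≠ v := by
  obtain ⟨m, hm⟩ : ∃ m, Fintype.card V = m + 2 := ⟨_, (Nat.sub_add_cancel h).symm⟩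
  let e : V ≃ Fin (m + 2) := Fintype.equivFinOfCardEq hm
  refine ⟨(e.trans (finRotate (m + 2))).trans e.symm, fun v hv => ?_⟩
  have h1 : finRotate (m + 2) (e v) = e v := by
    have := congrArg e hv
    simpa using this
  rw [finRotate_apply] at h1
  simp at h1

open Finset in
lemma avg_aux {ι V : Type} [Fintype ι] [DecidableEq ι] [Fintype V] [DecidableEq V]
    (v : V → ℚ) (hv : Function.Injective v) (h2 : 2 ≤ Fintype.card V)
    (a : ι → ℚ) (ha : ∀ i, a i ≠ 0) (b : ℚ) :
    2 ^ Fintype.card ι * (univ.filter fun s : ι → V => ∑ i, a i * v (s i) = b).card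
      ≤ Fintype.card V ^ Fintype.card ι * (Fintype.card ι).choose (Fintype.card ι / 2) := by
  classical
  obtain ⟨σ, hσ⟩ := exists_fpf h2
  let F : Finset ι → Equiv.Perm (ι → V) := fun T =>
    Equiv.piCongrRight fun i => if i ∈ T then σ else Equiv.refl V
  let P : (ι → V) → Prop := fun s => ∑ i, a i * v (s i) = b
  have e1 : ∀ T : Finset ι, (univ.filter P).card = (univ.filter fun s => P (F T s)).card := by
    intro T
    symm
    refine Finset.card_bij (fun s _ => F T s) ?_ ?_ ?_
    · intro s hs; simpa using hs
    · intro s _ t _ h; exact (F T).injective h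
    · intro t ht; exact ⟨(F T).symm t, by simpa using ht, by simp⟩
  have e2 : ∀ s : ι → V, (univ.filter fun T : Finset ι => P (F T s)).card
      ≤ (Fintype.card ι).choose (Fintype.card ι / 2) := by
    intro s
    have := lo_aux (fun i => a i * (v (σ (s i)) - v (s i)))
      (fun i => mul_ne_zero (ha i) (sub_ne_zero.2 fun h => hσ _ (hv h)))
      (b - ∑ i, a i * v (s i))
    refine le_trans (le_of_eq ?_) this
    congr 1
    ext T
    simp only [mem_filter, mem_univ, true_and, P]
    have : ∑ i, a i * v (F T s i)
        = ∑ i ∈ T, a i * (v (σ (s i)) - v (s i)) + ∑ i, a i * v (s i) := by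
      have e : ∀ (f : ι → ℚ), ∑ i ∈ T, f i = ∑ i, if i ∈ T then f i else 0 := by
        intro f; simp
      rw [e, ← Finset.sum_add_distrib]
      refine Finset.sum_congr rfl fun i _ => ?_
      by_cases hT : i ∈ T
      · simp [F, hT]; ring
      · simp [F, hT]
    rw [this, eq_sub_iff_add_eq]
  calc 2 ^ Fintype.card ι * (univ.filter P).card
      = ∑ T : Finset ι, (univ.filter fun s => P (F T s)).card := by
        rw [Finset.sum_congr rfl fun T _ => (e1 T).symm]; simp
    _ = ∑ s : ι → V, (univ.filter fun T : Finset ι => P (F T s)).card := by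
        simp only [Finset.card_filter]; exact Finset.sum_comm
    _ ≤ ∑ s : ι → V, (Fintype.card ι).choose (Fintype.card ι / 2) :=
        Finset.sum_le_sum fun s _ => e2 s
    _ = _ := by simp

open Finset in
lemma count_aux (n : ℕ) (W : Finset ℚ) (a : Fin n → ℤ) (b : ℚ) :
    ((Fintype.piFinset fun _ : Fin n => W).filter
        (fun s : Fin n → ℚ => ∑ i, (a i : ℚ) * s i = b)).card
    ≤ (univ.filter fun s : {i // a i ≠ 0} → W => ∑ i : {i // a i ≠ 0}, (a i : ℚ) * (s i : ℚ) = b).card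
      * W.card ^ (Fintype.card {i // ¬ a i ≠ 0}) := by
  classical
  have : W.card ^ (Fintype.card {i // ¬ a i ≠ 0})
      = (univ : Finset ({i // ¬ a i ≠ 0} → W)).card := by simp
  rw [this, ← Finset.card_product]
  rw [← Finset.card_attach]
  have hm : ∀ s : {s // s ∈ (Fintype.piFinset fun _ : Fin n => W).filter
        (fun s : Fin n → ℚ => ∑ i, (a i : ℚ) * s i = b)}, ∀ i, s.1 i ∈ W := by
    intro s i
    have := s.2
    rw [mem_filter, Fintype.mem_piFinset] at this
    exact this.1 i
  refine Finset.card_le_card_of_injOn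
    (fun s => (fun i => ⟨s.1 i, hm s i⟩, fun i => ⟨s.1 i, hm s i⟩)) ?_ ?_
  · intro s _
    have hs := (mem_filter.1 s.2).2
    simp only [coe_product, Set.mem_prod, mem_coe, mem_filter, mem_univ, true_and, and_true]
    refine Eq.trans ?_ hs
    rw [← Fintype.sum_subtype_add_sum_subtype (fun i => a i ≠ 0) (fun i => (a i : ℚ) * s.1 i)]
    rw [left_eq_add]
    refine Finset.sum_eq_zero fun i _ => ?_
    have := not_not.1 i.2
    simp [this]
  · intro s _ t _ h
    simp only [Prod.mk.injEq] at h
    apply Subtype.ext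
    funext i
    by_cases hi : a i ≠ 0
    · simpa using congrArg Subtype.val (congrFun h.1 ⟨i, hi⟩)
    · simpa using congrArg Subtype.val (congrFun h.2 ⟨i, hi⟩)


/-- let `W ⊆ [0,1] ∩ ℚ` be finite with `0 ∈ W` and `|W| = k ≥ 2`,
let `a ∈ ℤ^n` be a nonzero vector of width `w(a)` (its number of nonzero
coordinates) and `b ∈ ℚ`.  The number of points `s ∈ W^n` with `∑ i, a i * s i = b`
is at most `k^n / √(w(a))`. -/
theorem statement_2 (n : ℕ)
    (W : Finset ℚ) (hW0 : (0 : ℚ) ∈ W) (hWrange : ∀ s ∈ W, 0 ≤ s ∧ s ≤ 1)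
    (k : ℕ) (hk : W.card = k) (hk2 : 2 ≤ k)
    (a : Fin n → ℤ) (ha : a ≠ 0) (b : ℚ)
    (w : ℕ) (hw : w = (Finset.univ.filter fun i => a i ≠ 0).card) :
    (((Fintype.piFinset fun _ : Fin n => W).filter
        (fun s : Fin n → ℚ => ∑ i, (a i : ℚ) * s i = b)).card : ℝ)
      ≤ (k : ℝ) ^ n / Real.sqrt w := by
  have hc := count_aux n W a b
  have hav := avg_aux (ι := {i // a i ≠ 0}) (V := W) (fun x => (x : ℚ)) Subtype.val_injective
    (by simpa [hk] using hk2) (fun i => (a i : ℚ)) (fun i => by exact_mod_cast i.2) b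
  have hwc : Fintype.card {i // a i ≠ 0} = w := by rw [hw, Fintype.card_subtype]
  have hwn : w + Fintype.card {i // ¬ a i ≠ 0} = n := by
    rw [← hwc]
    have := Fintype.card_subtype_compl (fun i => a i ≠ 0)
    have h2 := Fintype.card_subtype_le (fun i => a i ≠ 0)
    rw [Fintype.card_fin] at this h2
    omega
  have hwpos : 0 < w := by
    rw [← hwc, Fintype.card_pos_iff]
    obtain ⟨i, hi⟩ := Function.ne_iff.1 ha
    exact ⟨⟨i, hi⟩⟩
  rw [hwc, Fintype.card_coe, hk] at hav
  rw [hk] at hc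
  have hch := choose_aux w
  set z := Fintype.card {i // ¬ a i ≠ 0}
  set N := ((Fintype.piFinset fun _ : Fin n => W).filter
        (fun s : Fin n → ℚ => ∑ i, (a i : ℚ) * s i = b)).card
  set C := w.choose (w / 2)
  have h1 : 2 ^ w * N ≤ k ^ n * C := by
    calc 2 ^ w * N ≤ _ := Nat.mul_le_mul_left _ hc
      _ = _ := (mul_assoc _ _ _).symm
      _ ≤ k ^ w * C * k ^ z := Nat.mul_le_mul_right _ hav
      _ = k ^ n * C := by rw [← hwn]; ring
  have h3 : (Real.sqrt w) * C ≤ 2 ^ w := by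
    apply le_of_sq_le_sq _ (by positivity)
    rw [mul_pow, Real.sq_sqrt (by positivity), ← pow_mul, mul_comm w 2, pow_mul]
    norm_num
    exact_mod_cast hch
  have h1' : (2 : ℝ) ^ w * N ≤ k ^ n * C := by exact_mod_cast h1
  rw [le_div_iff₀ (by positivity)]
  have h4 : (2 : ℝ) ^ w * (N * Real.sqrt w) ≤ 2 ^ w * k ^ n := by
    calc (2 : ℝ) ^ w * (N * Real.sqrt w) = (2 ^ w * N) * Real.sqrt w := by ring
      _ ≤ (k ^ n * C) * Real.sqrt w := by gcongr
      _ = k ^ n * (Real.sqrt w * C) := by ring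
      _ ≤ k ^ n * 2 ^ w := by gcongr
      _ = _ := by ring
  exact le_of_mul_le_mul_left h4 (by positivity)
end

section
/- For every n ≥ 1: every point x ∈ {0,1/2}^n having at least four coordinates equal to 1/2 satisfies all inequalities of SPHP_n, and the number of such points is at least 2^n − 4n^3. In particular, SPHP_n has at least 2^n − 4n^3 admissible points in {0,1/2}^n. -/
/-- for every `n ≥ 1`, every point `x ∈ {0,1/2}^n` with at least four
coordinates equal to `1/2` satisfies all inequalities of `SPHP_n`
(`∑ i, x i ≥ 2` and `x i + x j ≤ 1` for `i ≠ j`); there are at least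
`2^n - 4 n^3` such points; and in particular `SPHP_n` has at least `2^n - 4 n^3`
admissible points in `{0,1/2}^n`. -/
theorem statement_3 (n : ℕ) (hn : 1 ≤ n) :
    (∀ x : Fin n → ℚ, (∀ i, x i = 0 ∨ x i = 1/2) →
      4 ≤ (Finset.univ.filter fun i => x i = 1/2).card →
      (2 ≤ ∑ i, x i ∧ ∀ i j, i ≠ j → x i + x j ≤ 1)) ∧
    ((2 : ℤ) ^ n - 4 * (n : ℤ) ^ 3 ≤
      (((Fintype.piFinset fun _ : Fin n => ({0, 1/2} : Finset ℚ)).filter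
        (fun x => 4 ≤ (Finset.univ.filter fun i => x i = 1/2).card)).card : ℤ)) ∧
    ((2 : ℤ) ^ n - 4 * (n : ℤ) ^ 3 ≤
      (((Fintype.piFinset fun _ : Fin n => ({0, 1/2} : Finset ℚ)).filter
        (fun x => 2 ≤ ∑ i, x i ∧ ∀ i j, i ≠ j → x i + x j ≤ 1)).card : ℤ)) := by
  have h1 : ∀ x : Fin n → ℚ, (∀ i, x i = 0 ∨ x i = 1/2) →
      4 ≤ (Finset.univ.filter fun i => x i = 1/2).card →
      (2 ≤ ∑ i, x i ∧ ∀ i j, i ≠ j → x i + x j ≤ 1) := by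
    intro x hx h4
    constructor
    · have hs : ∑ i, x i = ∑ i, if x i = 1/2 then (1/2 : ℚ) else 0 := by
        apply Finset.sum_congr rfl
        intro i _
        split_ifs with h
        · exact h
        · exact (hx i).resolve_right h
      rw [hs, ← Finset.sum_filter, Finset.sum_const, nsmul_eq_mul]
      have h4' : (4 : ℚ) ≤ ((Finset.univ.filter fun i => x i = 1/2).card : ℚ) := by
        exact_mod_cast h4
      linarith
    · intro i j _
      rcases hx i with h | h <;> rcases hx j with h' | h' <;> rw [h, h'] <;> norm_num
  have h2 : (2 : ℤ) ^ n - 4 * (n : ℤ) ^ 3 ≤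
      (((Fintype.piFinset fun _ : Fin n => ({0, 1/2} : Finset ℚ)).filter
        (fun x => 4 ≤ (Finset.univ.filter fun i => x i = 1/2).card)).card : ℤ) := by
    have htot : (Fintype.piFinset fun _ : Fin n => ({0, 1/2} : Finset ℚ)).card = 2 ^ n := by
      rw [Fintype.card_piFinset_const, Finset.card_pair (by norm_num)]
    have hsplit := Finset.card_filter_add_card_filter_not
      (s := Fintype.piFinset fun _ : Fin n => ({0, 1/2} : Finset ℚ))
      (fun x => 4 ≤ (Finset.univ.filter fun i => x i = 1/2).card)
    have hbad : ((Fintype.piFinset fun _ : Fin n => ({0, 1/2} : Finset ℚ)).filter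
        (fun x => ¬ 4 ≤ (Finset.univ.filter fun i => x i = 1/2).card)).card ≤ 4 * n ^ 3 := by
      calc _ ≤ ((Finset.range 4).biUnion fun k =>
              Finset.powersetCard k (Finset.univ : Finset (Fin n))).card := by
            apply Finset.card_le_card_of_injOn
              (fun x => Finset.univ.filter fun i => x i = 1/2)
            · intro x hx
              have hx' := (Finset.mem_filter.1 hx).2
              simp only [Finset.coe_biUnion, Set.mem_iUnion, Finset.mem_coe,
                Finset.mem_range, Finset.mem_powersetCard]
              exact ⟨_, not_le.1 hx', Finset.subset_univ _, rfl⟩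
            · intro x hx y hy hxy
              have hx' := Fintype.mem_piFinset.1 (Finset.mem_filter.1 hx).1
              have hy' := Fintype.mem_piFinset.1 (Finset.mem_filter.1 hy).1
              funext i
              have hi : x i = 1/2 ↔ y i = 1/2 := by
                simpa using Finset.ext_iff.1 hxy i
              have a := hx' i
              have b := hy' i
              rw [Finset.mem_insert, Finset.mem_singleton] at a b
              rcases a with a | a
              · rcases b with b | b
                · rw [a, b]
                · rw [hi.2 b, b]
              · rw [a, hi.1 a]
        _ ≤ ∑ k ∈ Finset.range 4, (Finset.powersetCard k (Finset.univ : Finset (Fin n))).card :=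
            Finset.card_biUnion_le
        _ ≤ ∑ k ∈ Finset.range 4, n ^ 3 := by
            apply Finset.sum_le_sum
            intro k hk
            rw [Finset.card_powersetCard, Finset.card_univ, Fintype.card_fin]
            have hk' := Finset.mem_range.1 hk
            exact (Nat.choose_le_pow n k).trans (Nat.pow_le_pow_right hn (by omega))
        _ = 4 * n ^ 3 := by simp
    rw [htot] at hsplit
    generalize ((Fintype.piFinset fun _ : Fin n => ({0, 1/2} : Finset ℚ)).filter
        (fun x => 4 ≤ (Finset.univ.filter fun i => x i = 1/2).card)).card = A at hsplit ⊢
    have h3 : 2 ^ n ≤ A + 4 * n ^ 3 := by omega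
    have h4 : (2 : ℤ) ^ n ≤ A + 4 * (n : ℤ) ^ 3 := by exact_mod_cast h3
    linarith
  refine ⟨h1, h2, h2.trans ?_⟩
  norm_cast
  apply Finset.card_le_card
  intro x hx
  rw [Finset.mem_filter] at hx ⊢
  refine ⟨hx.1, h1 x (fun i => ?_) hx.2⟩
  have a := Fintype.mem_piFinset.1 hx.1 i
  rwa [Finset.mem_insert, Finset.mem_singleton] at a
end

section
/- There exist a constant c > 0 and N ∈ ℕ such that for all n ≥ N: if Q is a finite set of queries over the variables x_1,…,x_n whose slabs cover every point of {0,1/2,1}^n satisfying all inequalities of SPHP_n, then |Q| ≥ c·n^{1/4}. -/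
open MvPolynomial in
lemma alt_sum_zero {n : ℕ} (P : MvPolynomial (Fin n) ℤ) (h : P.totalDegree < n) :
    ∑ y : Fin n → Fin 2, (∏ i, (-1 : ℤ) ^ (y i : ℕ)) * eval (fun i => ((y i : ℕ) : ℤ)) P = 0 := by
  simp_rw [MvPolynomial.eval_eq', Finset.mul_sum]
  rw [Finset.sum_comm]
  refine Finset.sum_eq_zero fun m hm => ?_
  simp_rw [mul_left_comm _ (coeff m P), ← Finset.mul_sum, ← Finset.prod_mul_distrib]
  have hex : ∃ i, m i = 0 := by
    by_contra hc
    push Not at hc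
    have h1 : (m.sum fun _ e => e) ≤ P.totalDegree := le_totalDegree hm
    rw [Finsupp.sum_fintype _ _ (fun _ => rfl)] at h1
    have h2 : ∑ i : Fin n, 1 ≤ ∑ i, m i :=
      Finset.sum_le_sum fun i _ => Nat.one_le_iff_ne_zero.mpr (hc i)
    simp at h2
    omega
  obtain ⟨i, hi⟩ := hex
  have key := Finset.prod_univ_sum (fun _ : Fin n => (Finset.univ : Finset (Fin 2)))
    (fun i (z : Fin 2) => (-1 : ℤ) ^ (z : ℕ) * ((z : ℕ) : ℤ) ^ m i)
  rw [Fintype.piFinset_univ] at key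
  rw [← key, Finset.prod_eq_zero (Finset.mem_univ i), mul_zero]
  simp [Fin.sum_univ_two, hi]

open MvPolynomial in
lemma cover_bound {n : ℕ} (Q : Finset ((Fin n → ℤ) × ℤ))
    (h : ∀ y : Fin n → Fin 2, 4 ≤ ∑ i, ((y i : ℕ) : ℤ) →
      ∃ a ∈ Q, ∑ i, a.1 i * ((y i : ℕ) : ℤ) = 2 * a.2 - 1) : n ≤ Q.card + 3 := by
  by_contra hc
  push Not at hc
  let L : (Fin n → ℤ) → ℤ → MvPolynomial (Fin n) ℤ := fun a b => ∑ i, C (a i) * X i - C b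
  have hL : ∀ a b, (L a b).totalDegree ≤ 1 := by
    intro a b
    refine (totalDegree_sub_C_le _ _).trans ?_
    refine totalDegree_finsetSum_le fun i _ => ?_
    refine (totalDegree_mul _ _).trans ?_
    rw [totalDegree_C, totalDegree_X]
  have hLe : ∀ a b (y : Fin n → ℤ), eval y (L a b) = ∑ i, a i * y i - b := by
    intro a b y
    simp [L]
  let P : MvPolynomial (Fin n) ℤ :=
    (∏ a ∈ Q, L a.1 (2 * a.2 - 1)) * ∏ k ∈ Finset.range 3, L (fun _ => 1) (k + 1)
  have hP : P.totalDegree < n := by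
    refine lt_of_le_of_lt ?_ hc
    refine (totalDegree_mul _ _).trans (add_le_add ?_ ?_)
    · refine (totalDegree_finsetProd _ _).trans ?_
      refine (Finset.sum_le_sum fun a _ => hL _ _).trans ?_
      simp
    · refine (totalDegree_finsetProd _ _).trans ?_
      refine (Finset.sum_le_sum fun a _ => hL _ _).trans ?_
      simp
  have hs := alt_sum_zero P hP
  rw [Finset.sum_eq_single (0 : Fin n → Fin 2)] at hs
  · simp only [P, map_mul, map_prod, hLe, Pi.zero_apply, mul_eq_zero, Finset.prod_eq_zero_iff] at hs
    rcases hs with ⟨i, _, hs⟩ | ⟨a, _, hs⟩ | ⟨k, _, hs⟩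
    · simp at hs
    · simp at hs
      omega
    · simp at hs
      omega
  · intro y _ hy
    refine mul_eq_zero_of_right _ ?_
    simp only [P, map_mul, map_prod, hLe, mul_eq_zero, Finset.prod_eq_zero_iff]
    by_cases h4 : 4 ≤ ∑ i, ((y i : ℕ) : ℤ)
    · obtain ⟨a, ha, he⟩ := h y h4
      exact Or.inl ⟨a, ha, by rw [he]; ring⟩
    · right
      obtain ⟨j, hj⟩ := Function.ne_iff.mp hy
      have h1 : ((y j : ℕ) : ℤ) ≤ ∑ i, ((y i : ℕ) : ℤ) :=
        Finset.single_le_sum (f := fun i => ((y i : ℕ) : ℤ)) (fun i _ => by positivity)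
          (Finset.mem_univ j)
      have h2 : 1 ≤ (y j : ℕ) := by
        rw [Nat.one_le_iff_ne_zero]
        intro h0
        exact hj (Fin.ext h0)
      refine ⟨(∑ i, ((y i : ℕ) : ℤ) - 1).toNat, ?_, ?_⟩
      · rw [Finset.mem_range]; omega
      · simp only [one_mul]; omega
  · simp

/-- there are `c > 0` and `N` such that for all `n ≥ N`, every finite
set `Q` of queries over `x_1, …, x_n` whose slabs cover every point of
`{0,1/2,1}^n` satisfying all inequalities of `SPHP_n`
(`∑ i, x i ≥ 2` and `x i + x j ≤ 1` for `i ≠ j`) has `|Q| ≥ c · n^{1/4}`. -/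
theorem statement_4 : ∃ c : ℝ, 0 < c ∧ ∃ N : ℕ, ∀ n ≥ N,
    ∀ Q : Finset ((Fin n → ℤ) × ℤ),
    (∀ x : Fin n → ℝ, (∀ i, x i = 0 ∨ x i = 1/2 ∨ x i = 1) →
      2 ≤ ∑ i, x i → (∀ i j, i ≠ j → x i + x j ≤ 1) →
      ∃ a ∈ Q, (a.2 : ℝ) - 1 < ∑ i, (a.1 i : ℝ) * x i ∧
        ∑ i, (a.1 i : ℝ) * x i < (a.2 : ℝ)) →
    c * (n : ℝ) ^ ((1 : ℝ) / 4) ≤ (Q.card : ℝ) := by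
  refine ⟨1/4, by norm_num, 4, fun n hn Q h => ?_⟩
  have hb : n ≤ Q.card + 3 := by
    refine cover_bound Q fun y hy => ?_
    have hy01 : ∀ i, (y i : ℕ) = 0 ∨ (y i : ℕ) = 1 := fun i => by omega
    have hx := h (fun i => ((y i : ℕ) : ℝ) / 2)
    suffices hsuff : (∀ i, ((y i : ℕ) : ℝ) / 2 = 0 ∨ ((y i : ℕ) : ℝ) / 2 = 1/2 ∨
        ((y i : ℕ) : ℝ) / 2 = 1) ∧ 2 ≤ ∑ i, ((y i : ℕ) : ℝ) / 2 ∧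
        (∀ i j, i ≠ j → ((y i : ℕ) : ℝ) / 2 + ((y j : ℕ) : ℝ) / 2 ≤ 1) by
      obtain ⟨a, ha, h1, h2⟩ := hx hsuff.1 hsuff.2.1 hsuff.2.2
      refine ⟨a, ha, ?_⟩
      have he : ∑ i, (a.1 i : ℝ) * (((y i : ℕ) : ℝ) / 2)
          = ((∑ i, a.1 i * ((y i : ℕ) : ℤ) : ℤ) : ℝ) / 2 := by
        push_cast
        rw [Finset.sum_div]
        exact Finset.sum_congr rfl fun i _ => by ring
      rw [he] at h1 h2
      have h1' : 2 * a.2 - 2 < ∑ i, a.1 i * ((y i : ℕ) : ℤ) := by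
        have : ((2 * a.2 - 2 : ℤ) : ℝ) < ((∑ i, a.1 i * ((y i : ℕ) : ℤ) : ℤ) : ℝ) := by
          rw [Int.cast_sub, Int.cast_mul, Int.cast_ofNat]; linarith
        exact_mod_cast this
      have h2' : ∑ i, a.1 i * ((y i : ℕ) : ℤ) < 2 * a.2 := by
        have : ((∑ i, a.1 i * ((y i : ℕ) : ℤ) : ℤ) : ℝ) < ((2 * a.2 : ℤ) : ℝ) := by
          rw [Int.cast_mul, Int.cast_ofNat]; linarith
        exact_mod_cast this
      omega
    refine ⟨?_, ?_, ?_⟩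
    · intro i
      rcases hy01 i with h0 | h0 <;> simp [h0]
    · rw [← Finset.sum_div]
      have : (4 : ℝ) ≤ ∑ i, ((y i : ℕ) : ℝ) := by exact_mod_cast hy
      linarith
    · intro i j _
      rcases hy01 i with h0 | h0 <;> rcases hy01 j with h3 | h3 <;> simp [h0, h3] <;> norm_num
  have hn' : (4 : ℝ) ≤ n := by exact_mod_cast hn
  have hb' : (n : ℝ) ≤ Q.card + 3 := by exact_mod_cast hb
  have hr : (n : ℝ) ^ ((1 : ℝ) / 4) ≤ n := by
    calc (n : ℝ) ^ ((1 : ℝ) / 4) ≤ (n : ℝ) ^ (1 : ℝ) :=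
          Real.rpow_le_rpow_of_exponent_le (by linarith) (by norm_num)
      _ = n := Real.rpow_one _
  linarith
end

section
/- Let n ≥ 2, let N = n(n−1)/2 be the number of edges of the complete graph K_n, and let ω be any odd charging of the vertices of K_n. Then the number of admissible points of TS(K_n, ω) is at least 3^N · (1 − n²·2^{n−2}/3^{n−1}). -/
/-- The edges of the complete graph `K_n` on vertex set `Fin n`: non-diagonal
unordered pairs. -/
abbrev EdgeK (n : ℕ) := {e : Sym2 (Fin n) // ¬ e.IsDiag}

/-- `x ∈ {0,1/2,1}^{E(K_n)}` is an admissible point of the Tseitin contradiction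
`TS(K_n, ω)`: for every vertex `v`, either at least two edges incident to `v`
have value `1/2`, or no incident edge has value `1/2` and the sum of the values
of the incident edges (equivalently, the number of incident edges of value `1`)
is `≡ ω v (mod 2)`. -/
def TSKAdmissible (n : ℕ) (ω : Fin n → ZMod 2) (x : EdgeK n → ℚ) : Prop :=
  (∀ e, x e = 0 ∨ x e = 1/2 ∨ x e = 1) ∧
  ∀ v : Fin n,
    2 ≤ (Finset.univ.filter fun e : EdgeK n => v ∈ e.1 ∧ x e = 1/2).card ∨
    ((∀ e : EdgeK n, v ∈ e.1 → x e ≠ 1/2) ∧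
      (((Finset.univ.filter fun e : EdgeK n => v ∈ e.1 ∧ x e = 1).card : ZMod 2) = ω v))

instance (n : ℕ) (ω : Fin n → ZMod 2) : DecidablePred (TSKAdmissible n ω) := fun x => by
  unfold TSKAdmissible; infer_instance

/-- Edges of `K_n` incident to `v`. -/
def incS (n : ℕ) (v : Fin n) : Finset (EdgeK n) := Finset.univ.filter fun e => v ∈ e.1

lemma incS_card (n : ℕ) (v : Fin n) : (incS n v).card = n - 1 := by
  have h : (Finset.univ.erase v).card = n - 1 := by simp
  rw [← h]
  symm
  refine Finset.card_bij (fun w hw => ⟨s(v, w), by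
    simpa [eq_comm] using Finset.ne_of_mem_erase hw⟩) ?_ ?_ ?_
  · intro w hw; simp [incS]
  · intro a ha b hb hab
    have := congrArg Subtype.val hab
    have h2 : a = b ∨ v = b ∧ a = v := by simpa using this
    rcases h2 with h2 | ⟨h2, h3⟩
    · exact h2
    · exact h3.trans h2
  · rintro ⟨e, he⟩ hv
    have hv' : v ∈ e := by simpa [incS] using hv
    obtain ⟨w, rfl⟩ := hv'
    refine ⟨w, ?_, rfl⟩
    simp only [Sym2.isDiag_iff_proj_eq] at he
    simpa [eq_comm] using he

/-- The box of points whose only half-valued edge at `v` is `e`. -/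
def box (n : ℕ) (v : Fin n) (e : EdgeK n) : Finset (EdgeK n → ℚ) :=
  Fintype.piFinset fun f => if f = e then {1/2} else if v ∈ f.1 then {0, 1} else {0, 1/2, 1}

lemma box_card (n : ℕ) (v : Fin n) (e : EdgeK n) (he : e ∈ incS n v) :
    (box n v e).card = 2 ^ (n - 2) * 3 ^ (n * (n - 1) / 2 - (n - 1)) := by
  have hE : Fintype.card (EdgeK n) = n * (n - 1) / 2 := by
    rw [Sym2.card_subtype_not_diag, Fintype.card_fin, Nat.choose_two_right]
  have h3 : ({0, 1/2, 1} : Finset ℚ).card = 3 := by norm_num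
  have h2 : ({0, 1} : Finset ℚ).card = 2 := by norm_num
  rw [box, Fintype.card_piFinset, ← Finset.prod_mul_prod_compl (incS n v),
    ← Finset.mul_prod_erase _ _ he, if_pos rfl, Finset.card_singleton, one_mul]
  congr 1
  · rw [Finset.prod_congr rfl (g := fun _ => 2), Finset.prod_const, Finset.card_erase_of_mem he,
      incS_card, Nat.sub_sub]
    intro f hf
    rw [Finset.mem_erase] at hf
    have : v ∈ f.1 := by simpa [incS] using hf.2
    rw [if_neg hf.1, if_pos this, h2]
  · rw [Finset.prod_congr rfl (g := fun _ => 3), Finset.prod_const, Finset.card_compl,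
      incS_card, hE]
    intro f hf
    have hf' : f ∉ incS n v := by simpa using hf
    have h1 : f ≠ e := fun h => hf' (h ▸ he)
    have : v ∉ f.1 := by simpa [incS] using hf'
    rw [if_neg h1, if_neg this, h3]

lemma card_parity (n : ℕ) (v : Fin n) (e : EdgeK n) (he : v ∈ e.1) (x y : EdgeK n → ℚ)
    (hxy : ∀ f, f ≠ e → x f = y f) (hx : x e = 1) (hy : y e ≠ 1) :
    (Finset.univ.filter fun e : EdgeK n => v ∈ e.1 ∧ x e = 1).card =
    (Finset.univ.filter fun e : EdgeK n => v ∈ e.1 ∧ y e = 1).card + 1 := by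
  rw [← Finset.card_insert_of_notMem (a := e) (by simp [hy])]
  congr 1
  ext f
  by_cases hf : f = e
  · subst hf; simp [he, hx]
  · simp [hf, hxy f hf]

/-- All ternary points. -/
def cube (n : ℕ) : Finset (EdgeK n → ℚ) :=
  Fintype.piFinset fun _ : EdgeK n => ({0, 1/2, 1} : Finset ℚ)

/-- Points with no half at `v` and wrong parity at `v`. -/
def wrong (n : ℕ) (ω : Fin n → ZMod 2) (v : Fin n) : Finset (EdgeK n → ℚ) :=
  (cube n).filter fun x => (∀ e : EdgeK n, v ∈ e.1 → x e ≠ 1/2) ∧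
      (((Finset.univ.filter fun e : EdgeK n => v ∈ e.1 ∧ x e = 1).card : ZMod 2) ≠ ω v)

lemma wrong_card (n : ℕ) (ω : Fin n → ZMod 2) (v : Fin n) (e : EdgeK n) (he : e ∈ incS n v) :
    (wrong n ω v).card ≤ (box n v e).card := by
  have hv : v ∈ e.1 := by simpa [incS] using he
  refine Finset.card_le_card_of_injOn (fun x => Function.update x e (1/2)) ?_ ?_
  · intro x hx
    simp only [wrong, cube, Finset.coe_filter, Set.mem_setOf_eq, Fintype.mem_piFinset] at hx
    obtain ⟨hc, hh, -⟩ := hx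
    simp only [box, Finset.mem_coe, Fintype.mem_piFinset]
    intro f
    by_cases hf : f = e
    · subst hf; simp
    · rw [if_neg hf, Function.update_of_ne hf]
      have := hc f
      split_ifs with h
      · have h2 := hh f h
        simp only [Finset.mem_insert, Finset.mem_singleton] at this ⊢
        tauto
      · exact this
  · intro x hx y hy hxy
    simp only [wrong, cube, Finset.coe_filter, Set.mem_setOf_eq, Fintype.mem_piFinset,
      Finset.mem_insert, Finset.mem_singleton] at hx hy
    have hoff : ∀ f, f ≠ e → x f = y f := by
      intro f hf
      have := congrFun hxy f
      simpa [Function.update_of_ne hf] using this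
    have key : ∀ a b c : ZMod 2, a ≠ c → b ≠ c → a = b + 1 → False := by decide
    have h1 := hx.1 e
    have h2 := hx.2.1 e hv
    have h3 := hy.1 e
    have h4 := hy.2.1 e hv
    have hee : x e = y e := by
      rcases h1 with h1 | h1 | h1
      · rcases h3 with h3 | h3 | h3
        · rw [h1, h3]
        · exact absurd h3 h4
        · exfalso
          refine key _ _ _ hy.2.2 hx.2.2 ?_
          rw [card_parity n v e hv y x (fun f hf => (hoff f hf).symm) h3 (by rw [h1]; norm_num)]
          push_cast; rfl
      · exact absurd h1 h2
      · rcases h3 with h3 | h3 | h3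
        · exfalso
          refine key _ _ _ hx.2.2 hy.2.2 ?_
          rw [card_parity n v e hv x y hoff h1 (by rw [h3]; norm_num)]
          push_cast; rfl
        · exact absurd h3 h4
        · rw [h1, h3]
    funext f
    by_cases hf : f = e
    · rw [hf, hee]
    · exact hoff f hf

lemma bad_sub (n : ℕ) (ω : Fin n → ZMod 2) :
    (cube n).filter (fun x => ¬ TSKAdmissible n ω x) ⊆
      Finset.univ.biUnion fun v => wrong n ω v ∪ (incS n v).biUnion (box n v) := by
  intro x hx
  rw [Finset.mem_filter] at hx
  obtain ⟨hc, hn⟩ := hx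
  have hc' : ∀ e, x e = 0 ∨ x e = 1/2 ∨ x e = 1 := by
    intro e
    have := Fintype.mem_piFinset.1 hc e
    simpa using this
  have : ∃ v, ¬ (2 ≤ (Finset.univ.filter fun e : EdgeK n => v ∈ e.1 ∧ x e = 1/2).card ∨
    ((∀ e : EdgeK n, v ∈ e.1 → x e ≠ 1/2) ∧
      (((Finset.univ.filter fun e : EdgeK n => v ∈ e.1 ∧ x e = 1).card : ZMod 2) = ω v))) := by
    by_contra h
    push Not at h
    exact hn ⟨hc', fun v => by
      have := h v
      tauto⟩
  obtain ⟨v, hv⟩ := this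
  rw [not_or] at hv
  obtain ⟨hv1, hv2⟩ := hv
  rw [Finset.mem_biUnion]
  refine ⟨v, Finset.mem_univ _, ?_⟩
  rw [Finset.mem_union]
  by_cases hh : ∀ e : EdgeK n, v ∈ e.1 → x e ≠ 1/2
  · left
    exact Finset.mem_filter.2 ⟨hc, hh, fun h => hv2 ⟨hh, h⟩⟩
  · right
    push Not at hh
    obtain ⟨e, he, hxe⟩ := hh
    rw [Finset.mem_biUnion]
    refine ⟨e, by simp [incS, he], ?_⟩
    have hle := Finset.card_le_one.1 (Nat.lt_succ_iff.1 (not_le.1 hv1))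
    refine Fintype.mem_piFinset.2 fun f => ?_
    by_cases hf : f = e
    · subst hf; simp [hxe]
    · rw [if_neg hf]
      split_ifs with h
      · have : x f ≠ 1/2 := fun h' => hf (hle f (Finset.mem_filter.2 ⟨Finset.mem_univ _, h, h'⟩) e
          (Finset.mem_filter.2 ⟨Finset.mem_univ _, he, hxe⟩))
        have := hc' f
        simp only [Finset.mem_insert, Finset.mem_singleton]
        tauto
      · exact Fintype.mem_piFinset.1 hc f

lemma bad_card (n : ℕ) (hn : 2 ≤ n) (ω : Fin n → ZMod 2) :
    ((cube n).filter (fun x => ¬ TSKAdmissible n ω x)).card ≤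
      n * (n * (2 ^ (n - 2) * 3 ^ (n * (n - 1) / 2 - (n - 1)))) := by
  refine (Finset.card_le_card (bad_sub n ω)).trans ?_
  refine (Finset.card_biUnion_le_card_mul _ _ _ ?_).trans (by rw [Finset.card_univ, Fintype.card_fin])
  intro v _
  have hb := Finset.card_biUnion_le_card_mul (incS n v) (box n v) _
    (fun e he => (box_card n v e he).le)
  rw [incS_card] at hb
  have hne : (incS n v).Nonempty := by
    rw [← Finset.card_pos, incS_card]; omega
  obtain ⟨e, he⟩ := hne
  have hw := wrong_card n ω v e he
  rw [box_card n v e he] at hw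
  refine (Finset.card_union_le _ _).trans ((add_le_add hw hb).trans ?_)
  obtain ⟨m, rfl⟩ : ∃ m, n = m + 1 := ⟨n - 1, by omega⟩
  simp only [Nat.add_sub_cancel]
  apply le_of_eq; ring

/-- for `n ≥ 2`, `N = n(n-1)/2` the number of edges of `K_n`, and `ω`
any odd charging of `K_n`, the number of admissible points of `TS(K_n, ω)` is at
least `3^N · (1 - n² · 2^{n-2} / 3^{n-1})`. -/
theorem statement_7 (n : ℕ) (hn : 2 ≤ n) (ω : Fin n → ZMod 2) (hω : ∑ v, ω v = 1) :
    (3 : ℝ) ^ (n * (n - 1) / 2) * (1 - (n : ℝ) ^ 2 * 2 ^ (n - 2) / 3 ^ (n - 1)) ≤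
      (((Fintype.piFinset fun _ : EdgeK n => ({0, 1/2, 1} : Finset ℚ)).filter
        (TSKAdmissible n ω)).card : ℝ) := by
  have hb := bad_card n hn ω
  have hs := Finset.card_filter_add_card_filter_not (s := cube n) (TSKAdmissible n ω)
  have hE : Fintype.card (EdgeK n) = n * (n - 1) / 2 := by
    rw [Sym2.card_subtype_not_diag, Fintype.card_fin, Nat.choose_two_right]
  have hc : (cube n).card = 3 ^ (n * (n - 1) / 2) := by
    have h3 : ({0, 1/2, 1} : Finset ℚ).card = 3 := by norm_num
    rw [cube, Fintype.card_piFinset, Finset.prod_const, h3, Finset.card_univ, hE]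
  have hle : n - 1 ≤ n * (n - 1) / 2 := by
    rw [← hE, ← incS_card n ⟨0, by omega⟩]
    exact Finset.card_le_univ _
  obtain ⟨k, hk⟩ := Nat.exists_eq_add_of_le hle
  rw [hc] at hs
  rw [hk] at hs hb ⊢
  rw [Nat.add_sub_cancel_left] at hb
  change _ ≤ (((cube n).filter (TSKAdmissible n ω)).card : ℝ)
  have hs' : (((cube n).filter (TSKAdmissible n ω)).card : ℝ) +
      (((cube n).filter (fun x => ¬ TSKAdmissible n ω x)).card : ℝ) = 3 ^ (n - 1 + k) := by
    exact_mod_cast hs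
  have hb' : (((cube n).filter (fun x => ¬ TSKAdmissible n ω x)).card : ℝ) ≤
      n * (n * (2 ^ (n - 2) * 3 ^ k)) := by exact_mod_cast hb
  have e : (3 : ℝ) ^ (n - 1 + k) * (1 - (n : ℝ) ^ 2 * 2 ^ (n - 2) / 3 ^ (n - 1)) =
      3 ^ (n - 1 + k) - n * (n * (2 ^ (n - 2) * 3 ^ k)) := by
    rw [pow_add]; field_simp
  rw [e]; linarith
end

section
/- There exist a constant c > 0 and N ∈ ℕ such that for every n ≥ N and every odd charging ω of K_n: every finite set Q of queries over the edge variables of K_n whose slabs cover all admissible points of TS(K_n, ω) satisfies |Q| ≥ c·n^{1/4}. -/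
open Finset in
lemma LO_fiber {α : Type*} [Fintype α] [DecidableEq α] (a : α → ℤ) (S B : Finset α)
    (hS : ∀ e ∈ S, a e ≠ 0) (t : ℤ) :
    (univ.filter fun A : Finset α => ∑ e ∈ A, a e = t ∧ A \ S = B).card
      ≤ S.card.choose (S.card / 2) := by
  classical
  set F := univ.filter fun A : Finset α => ∑ e ∈ A, a e = t ∧ A \ S = B with hF
  let g : Finset α → Finset S := fun A => univ.filter fun s : S => (s.1 ∈ A ↔ 0 < a s.1)
  have key : ∀ A ∈ F, ∀ A' ∈ F, g A ⊆ g A' → A = A' := by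
    intro A hA A' hA' hsub
    simp only [hF, mem_filter, mem_univ, true_and] at hA hA'
    have hout : ∀ e, e ∉ S → (e ∈ A ↔ e ∈ A') := by
      intro e he
      have h1 : e ∈ A \ S ↔ e ∈ A' \ S := by rw [hA.2, hA'.2]
      simpa [he] using h1
    have hin : ∀ e (he : e ∈ S), (e ∈ A ↔ 0 < a e) → (e ∈ A' ↔ 0 < a e) := by
      intro e he h
      have : (⟨e, he⟩ : S) ∈ g A := by simp [g, h]
      have := hsub this
      simpa [g] using this
    have hle : ∀ e ∈ (univ : Finset α), (if e ∈ A then a e else 0) ≤ (if e ∈ A' then a e else 0) := by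
      intro e _
      by_cases he : e ∈ S
      · have h1 := hin e he
        have h2 := hS e he
        clear hin hout hsub
        split_ifs <;> grind
      · simp [hout e he]
    have hsum : ∑ e, (if e ∈ A then a e else 0) = ∑ e, (if e ∈ A' then a e else 0) := by
      simp [hA.1, hA'.1]
    have heq := (Finset.sum_eq_sum_iff_of_le hle).1 hsum
    ext e
    by_cases he : e ∈ S
    · have h1 := heq e (mem_univ _)
      have h2 := hS e he
      by_cases h3 : e ∈ A <;> by_cases h4 : e ∈ A' <;> simp_all
    · exact hout e he
  have hinj : Set.InjOn g F := fun A hA A' hA' h => key A hA A' hA' h.subset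
  rw [← card_image_of_injOn hinj]
  have hanti : IsAntichain (· ⊆ ·) ((F.image g : Finset (Finset S)) : Set (Finset S)) := by
    intro X hX Y hY hne hsub
    simp only [coe_image, Set.mem_image, mem_coe] at hX hY
    obtain ⟨A, hA, rfl⟩ := hX
    obtain ⟨A', hA', rfl⟩ := hY
    exact hne (by rw [key A hA A' hA' hsub])
  have := hanti.sperner
  simpa using this

open Finset in
lemma LO {α : Type*} [Fintype α] [DecidableEq α] (a : α → ℤ) (S : Finset α)
    (hS : ∀ e ∈ S, a e ≠ 0) (t : ℤ) :
    (univ.filter fun A : Finset α => ∑ e ∈ A, a e = t).card * 2 ^ S.card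
      ≤ S.card.choose (S.card / 2) * 2 ^ (Fintype.card α) := by
  classical
  have h := Finset.card_le_mul_card_image_of_maps_to
    (s := univ.filter fun A : Finset α => ∑ e ∈ A, a e = t)
    (t := Sᶜ.powerset) (f := fun A => A \ S)
    (by intro A _; simp [Finset.subset_iff]) (S.card.choose (S.card / 2))
    (by
      intro B _
      rw [Finset.filter_filter]
      exact LO_fiber a S B hS t)
  rw [card_powerset] at h
  calc _ ≤ (S.card.choose (S.card / 2) * 2 ^ (Sᶜ.card)) * 2 ^ S.card := Nat.mul_le_mul_right _ h
    _ = _ := by rw [mul_assoc, ← pow_add, card_compl_add_card]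

lemma k_bound (k : ℕ) : k * (k ^ 2).centralBinom < 4 ^ (k ^ 2) := by
  have h := cb_bound (k ^ 2)
  have hp : 0 < (k ^ 2).centralBinom := Nat.centralBinom_pos _
  have : (k * (k ^ 2).centralBinom) ^ 2 < (4 ^ (k ^ 2)) ^ 2 := by
    calc (k * (k ^ 2).centralBinom) ^ 2 = (k ^ 2).centralBinom ^ 2 * k ^ 2 := by ring
      _ < (k ^ 2).centralBinom ^ 2 * (2 * k ^ 2 + 1) := by
        apply Nat.mul_lt_mul_of_pos_left
        · omega
        · positivity
      _ ≤ 16 ^ (k ^ 2) := h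
      _ = _ := by rw [← pow_mul, mul_comm, pow_mul]; norm_num
  exact lt_of_pow_lt_pow_left₀ 2 (by positivity) this

open Finset in
/-- abstract choice of an index avoiding few bad ones -/
lemma bad_card_s9 {α : Type*} [Fintype α] [DecidableEq α] (D : Finset ℕ) (H : ℕ → Finset α)
    (hdis : ∀ d ∈ D, ∀ d' ∈ D, ∀ e, e ∈ H d → e ∈ H d' → d = d') (a : α → ℤ) (w : ℕ) :
    (D.filter fun d => (∃ e ∈ H d, a e ≠ 0) ∧
      (univ.filter fun e => e ∉ H d ∧ a e ≠ 0).card < w).card ≤ w := by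
  classical
  set Bd := D.filter fun d => (∃ e ∈ H d, a e ≠ 0) ∧
      (univ.filter fun e => e ∉ H d ∧ a e ≠ 0).card < w with hB
  rcases Bd.eq_empty_or_nonempty with h0 | ⟨d0, hd0⟩
  · simp [h0]
  have hm : ∀ d ∈ Bd, d ∈ D ∧ (∃ e ∈ H d, a e ≠ 0) ∧
      (univ.filter fun e => e ∉ H d ∧ a e ≠ 0).card < w := by
    intro d hd; simpa [hB] using hd
  have hex : ∀ d, ∃ e, d ∈ Bd → e ∈ H d ∧ a e ≠ 0 := by
    obtain ⟨e0, _⟩ := (hm d0 hd0).2.1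
    intro d
    by_cases hd : d ∈ Bd
    · obtain ⟨e, he⟩ := (hm d hd).2.1
      exact ⟨e, fun _ => he⟩
    · exact ⟨e0, fun h => absurd h hd⟩
  choose f hf using hex
  have : (Bd.erase d0).card ≤ (univ.filter fun e => e ∉ H d0 ∧ a e ≠ 0).card := by
    apply card_le_card_of_injOn f
    · intro d hd
      have hd := mem_erase.1 (mem_coe.1 hd)
      have := hf d hd.2
      simp only [coe_filter, mem_univ, true_and, Set.mem_ofPred_eq]
      exact ⟨fun h => hd.1 (hdis d (hm d hd.2).1 d0 (hm d0 hd0).1 _ this.1 h), this.2⟩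
    · intro d hd d' hd' h
      have hd := mem_erase.1 (mem_coe.1 hd)
      have hd' := mem_erase.1 (mem_coe.1 hd')
      exact hdis d (hm d hd.2).1 d' (hm d' hd'.2).1 _ (hf d hd.2).1 (h ▸ (hf d' hd'.2).1)
  have h3 := (hm d0 hd0).2.2
  rw [card_erase_of_mem hd0] at this
  omega

open Finset in
lemma exists_good {α : Type*} [Fintype α] [DecidableEq α] (D : Finset ℕ) (H : ℕ → Finset α)
    (hdis : ∀ d ∈ D, ∀ d' ∈ D, ∀ e, e ∈ H d → e ∈ H d' → d = d')
    (Q : Finset ((α → ℤ) × ℤ)) (hcard : Q.card * (2 * Q.card ^ 2) < D.card) :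
    ∃ d ∈ D, ∃ A : Finset α, ∀ q ∈ Q,
      ∑ e ∈ H d, q.1 e + 2 * ∑ e ∈ A, (if e ∈ H d then 0 else q.1 e) ≠ 2 * q.2 - 1 := by
  classical
  set k := Q.card with hk
  set w := 2 * k ^ 2 with hw
  let Bd : ((α → ℤ) × ℤ) → Finset ℕ := fun q => D.filter fun d => (∃ e ∈ H d, q.1 e ≠ 0) ∧
      (univ.filter fun e => e ∉ H d ∧ q.1 e ≠ 0).card < w
  have h1 : (Q.biUnion Bd).card < D.card :=
    lt_of_le_of_lt (card_biUnion_le_card_mul _ _ w fun q _ => bad_card_s9 D H hdis q.1 w) hcard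
  obtain ⟨d, hd, hdB⟩ := exists_mem_notMem_of_card_lt_card h1
  refine ⟨d, hd, ?_⟩
  by_contra! hcon
  let T : ((α → ℤ) × ℤ) → Finset (Finset α) := fun q =>
    if ∃ e ∈ H d, q.1 e ≠ 0 then
      univ.filter fun A => ∑ e ∈ A, (if e ∈ H d then 0 else q.1 e) =
        (2 * q.2 - 1 - ∑ e ∈ H d, q.1 e) / 2
    else ∅
  have hcov : (univ : Finset (Finset α)) ⊆ Q.biUnion T := by
    intro A _
    obtain ⟨q, hq, hqA⟩ := hcon A
    rw [mem_biUnion]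
    refine ⟨q, hq, ?_⟩
    by_cases hz : ∃ e ∈ H d, q.1 e ≠ 0
    · simp only [T, if_pos hz, mem_filter, mem_univ, true_and]
      omega
    · push Not at hz
      rw [sum_eq_zero hz] at hqA
      omega
  have hT : ∀ q ∈ Q, (T q).card * 4 ^ (k ^ 2) ≤ (k ^ 2).centralBinom * 2 ^ Fintype.card α := by
    intro q hq
    by_cases hz : ∃ e ∈ H d, q.1 e ≠ 0
    · simp only [T, if_pos hz]
      have hnb : w ≤ (univ.filter fun e => e ∉ H d ∧ q.1 e ≠ 0).card := by
        by_contra hlt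
        exact hdB (mem_biUnion.2 ⟨q, hq, mem_filter.2 ⟨hd, hz, not_le.1 hlt⟩⟩)
      obtain ⟨S, hSs, hSc⟩ := exists_subset_card_eq hnb
      have := LO (fun e => if e ∈ H d then 0 else q.1 e) S (by
        intro e he
        have := mem_filter.1 (hSs he)
        simp [this.2.1, this.2.2]) ((2 * q.2 - 1 - ∑ e ∈ H d, q.1 e) / 2)
      rw [hSc, hw, Nat.mul_div_cancel_left _ (by norm_num), pow_mul] at this
      simpa [Nat.centralBinom] using this
    · simp [T, hz]
  have h2 : 2 ^ Fintype.card α ≤ ∑ q ∈ Q, (T q).card := by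
    calc 2 ^ Fintype.card α = (univ : Finset (Finset α)).card := by simp
      _ ≤ _ := card_le_card hcov
      _ ≤ _ := card_biUnion_le
  have h3 : 2 ^ Fintype.card α * 4 ^ (k ^ 2) ≤
      2 ^ Fintype.card α * (k * (k ^ 2).centralBinom) := by
    calc _ ≤ (∑ q ∈ Q, (T q).card) * 4 ^ (k ^ 2) := Nat.mul_le_mul_right _ h2
      _ = ∑ q ∈ Q, (T q).card * 4 ^ (k ^ 2) := by rw [sum_mul]
      _ ≤ ∑ q ∈ Q, (k ^ 2).centralBinom * 2 ^ Fintype.card α := sum_le_sum hT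
      _ = _ := by rw [sum_const, smul_eq_mul]; ring
  exact absurd (Nat.le_of_mul_le_mul_left h3 (by positivity)) (not_le.2 (k_bound k))

open Finset Fin.NatCast Fin.CommRing in
lemma key_bound (n : ℕ) (hn : 3 ≤ n) (ω : Fin n → ZMod 2) (Q : Finset ((EdgeK n → ℤ) × ℤ))
    (hQ : ∀ x : EdgeK n → ℚ, TSKAdmissible n ω x →
      ∃ a ∈ Q, (a.2 : ℝ) - 1 < ∑ e, (a.1 e : ℝ) * (x e : ℝ) ∧
        ∑ e, (a.1 e : ℝ) * (x e : ℝ) < (a.2 : ℝ)) :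
    (n - 1) / 2 ≤ Q.card * (2 * Q.card ^ 2) := by
  classical
  by_contra! hlt
  have : NeZero n := ⟨by omega⟩
  let D := Finset.Icc 1 ((n - 1) / 2)
  have hD : ∀ d ∈ D, 1 ≤ d ∧ 2 * d < n := by
    intro d hd
    have := Finset.mem_Icc.1 hd
    omega
  let H : ℕ → Finset (EdgeK n) := fun d =>
    univ.filter fun e => ∃ i : Fin n, e.1 = s(i, i + (d : Fin n))
  have hne : ∀ m : ℕ, 0 < m → m < n → (m : Fin n) ≠ 0 := by
    intro m h1 h2 h
    rw [Fin.natCast_eq_zero] at h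
    exact absurd (Nat.le_of_dvd h1 h) (by omega)
  have hdis : ∀ d ∈ D, ∀ d' ∈ D, ∀ e, e ∈ H d → e ∈ H d' → d = d' := by
    intro d hd d' hd' e he he'
    have hd := hD d hd
    have hd' := hD d' hd'
    obtain ⟨i, hi⟩ := (mem_filter.1 he).2
    obtain ⟨j, hj⟩ := (mem_filter.1 he').2
    rw [hi, Sym2.eq_iff] at hj
    rcases hj with ⟨h1, h2⟩ | ⟨h1, h2⟩
    · subst h1
      have h3 : (d : Fin n) = (d' : Fin n) := add_left_cancel h2
      have := congrArg Fin.val h3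
      rw [Fin.val_natCast, Fin.val_natCast, Nat.mod_eq_of_lt (by omega),
        Nat.mod_eq_of_lt (by omega)] at this
      exact this
    · exfalso
      apply hne (d' + d) (by omega) (by omega)
      rw [h1, add_assoc] at h2
      push_cast
      exact left_eq_add.1 h2.symm
  obtain ⟨d, hd, A, hA⟩ := exists_good D H hdis Q (by simpa [D] using hlt)
  have hd2 := hD d hd
  let x : EdgeK n → ℚ := fun e => if e ∈ H d then 1 / 2 else if e ∈ A then 1 else 0
  have hx : ∀ e ∈ H d, x e = 1 / 2 := fun e he => by simp only [x, if_pos he]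
  have hadm : TSKAdmissible n ω x := by
    refine ⟨?_, ?_⟩
    · intro e
      simp only [x]
      split_ifs <;> simp
    · intro v
      left
      have hd0 := hne d (by omega) (by omega)
      let e1 : EdgeK n := ⟨s(v, v + (d : Fin n)), by simpa using hd0⟩
      let e2 : EdgeK n := ⟨s(v - (d : Fin n), v), by simpa using hd0⟩
      have he1 : e1 ∈ H d := mem_filter.2 ⟨mem_univ _, v, rfl⟩
      have he2 : e2 ∈ H d := mem_filter.2 ⟨mem_univ _, v - (d : Fin n), by simp [e2]⟩
      have h12 : e1 ≠ e2 := by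
        intro h
        have h := congrArg Subtype.val h
        simp only [e1, e2] at h
        rw [Sym2.eq_iff] at h
        rcases h with ⟨h1, h2⟩ | ⟨h1, h2⟩
        · exact hd0 (by simpa using h2)
        · apply hne (d + d) (by omega) (by omega)
          push_cast
          have : v + ((d : Fin n) + (d : Fin n)) = v := by rw [← add_assoc, h2, sub_add_cancel]
          simpa using this
      rw [← card_pair h12]
      apply card_le_card
      intro e he
      simp only [mem_insert, mem_singleton] at he
      rw [mem_filter]
      rcases he with rfl | rfl
      · exact ⟨mem_univ _, by simp [e1], hx _ he1⟩
      · exact ⟨mem_univ _, by simp [e2], hx _ he2⟩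
  obtain ⟨q, hq, hlo, hhi⟩ := hQ x hadm
  apply hA q hq
  have hsum : 2 * ∑ e, (q.1 e : ℝ) * (x e : ℝ) =
      ((∑ e ∈ H d, q.1 e + 2 * ∑ e ∈ A, (if e ∈ H d then 0 else q.1 e) : ℤ) : ℝ) := by
    push_cast
    rw [← Finset.sum_filter_add_sum_filter_not univ (· ∈ H d), mul_add]
    have ha : ∀ f : EdgeK n → ℝ, ∑ e ∈ A, f e = ∑ e, if e ∈ A then f e else 0 := by
      intro f; simp
    congr 1
    · rw [Finset.filter_mem_eq_inter, univ_inter, mul_sum]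
      apply sum_congr rfl
      intro e he
      rw [hx e he]; push_cast; ring
    · congr 1
      rw [ha, Finset.sum_filter]
      apply sum_congr rfl
      intro e _
      by_cases h1 : e ∈ H d <;> by_cases h2 : e ∈ A <;> simp [x, h1, h2]
  have l1 : ((2 * q.2 - 2 : ℤ) : ℝ) <
      ((∑ e ∈ H d, q.1 e + 2 * ∑ e ∈ A, (if e ∈ H d then 0 else q.1 e) : ℤ) : ℝ) := by
    rw [← hsum]; push_cast; linarith
  have l2 : ((∑ e ∈ H d, q.1 e + 2 * ∑ e ∈ A, (if e ∈ H d then 0 else q.1 e) : ℤ) : ℝ) <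
      ((2 * q.2 : ℤ) : ℝ) := by
    rw [← hsum]; push_cast; linarith
  have l1 := Int.cast_lt.1 l1
  have l2 := Int.cast_lt.1 l2
  omega

/-- there are `c > 0` and `N` such that for every `n ≥ N` and every
odd charging `ω` of `K_n`, every finite set `Q` of queries over the edge
variables of `K_n` whose slabs cover all admissible points of `TS(K_n, ω)`
satisfies `|Q| ≥ c · n^{1/4}`. -/
theorem statement_9 : ∃ c : ℝ, 0 < c ∧ ∃ N : ℕ, ∀ n ≥ N,
    ∀ ω : Fin n → ZMod 2, ∑ v, ω v = 1 →
    ∀ Q : Finset ((EdgeK n → ℤ) × ℤ),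
    (∀ x : EdgeK n → ℚ, TSKAdmissible n ω x →
      ∃ a ∈ Q, (a.2 : ℝ) - 1 < ∑ e, (a.1 e : ℝ) * (x e : ℝ) ∧
        ∑ e, (a.1 e : ℝ) * (x e : ℝ) < (a.2 : ℝ)) →
    c * (n : ℝ) ^ ((1 : ℝ) / 4) ≤ (Q.card : ℝ) := by
  refine ⟨1 / 6, by norm_num, 3, ?_⟩
  intro n hn ω _ Q hQ
  have h := key_bound n hn ω Q hQ
  have hk : 1 ≤ Q.card := by
    by_contra h0
    have h0 : Q.card = 0 := by omega
    rw [h0] at h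
    omega
  set k := Q.card
  have h1 : n ≤ 4 * k ^ 3 + 2 := by
    have : k * (2 * k ^ 2) = 2 * k ^ 3 := by ring
    omega
  have h2 : n ≤ (6 * k) ^ 4 := by
    have h3 : k ^ 3 ≤ k ^ 4 := Nat.pow_le_pow_right hk (by norm_num)
    have h4 : 1 ≤ k ^ 3 := Nat.one_le_pow _ _ hk
    have h5 : (6 * k) ^ 4 = 1296 * k ^ 4 := by ring
    omega
  have h3 : (n : ℝ) ^ ((1 : ℝ) / 4) ≤ 6 * k := by
    have h4 : (n : ℝ) ≤ (6 * (k : ℝ)) ^ (4 : ℕ) := by exact_mod_cast h2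
    calc (n : ℝ) ^ ((1 : ℝ) / 4) ≤ ((6 * (k : ℝ)) ^ (4 : ℕ)) ^ ((1 : ℝ) / 4) :=
          Real.rpow_le_rpow (by positivity) h4 (by norm_num)
      _ = 6 * k := by
          rw [← Real.rpow_natCast, ← Real.rpow_mul (by positivity)]
          norm_num
  linarith
end

section
/- For every n and every X ⊆ [n] with |X| ≤ n − 3, there exists an admissible point x of LOP_n such that x(P_{i,j}) ∈ {0,1} whenever i ∈ X or j ∈ X, and x(P_{i,j}) = 1/2 whenever i ∉ X and j ∉ X. -/
/-- `x` (with `x i j` standing for the value of the variable `P_{i,j}`, `i ≠ j`)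
is an admissible point of `LOP_n`: all values (on off-diagonal pairs) lie in
`{0,1/2,1}` and all constraints of the Least Ordering Principle hold:
`P_{i,j} + P_{j,i} = 1`, `P_{i,k} ≥ P_{i,j} + P_{j,k} - 1` for pairwise distinct
`i,j,k`, and `∑_{i ≠ j} P_{i,j} ≥ 1` for every `j`. -/
def LOPAdmissible (n : ℕ) (x : Fin n → Fin n → ℚ) : Prop :=
  (∀ i j, i ≠ j → x i j = 0 ∨ x i j = 1/2 ∨ x i j = 1) ∧
  (∀ i j, i ≠ j → x i j + x j i = 1) ∧
  (∀ i j k, i ≠ j → j ≠ k → i ≠ k → x i j + x j k - 1 ≤ x i k) ∧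
  (∀ j, 1 ≤ ∑ i ∈ Finset.univ.filter (fun i => i ≠ j), x i j)

/-- for every `n` and every `X ⊆ [n]` with `|X| ≤ n - 3` there is an
admissible point `x` of `LOP_n` which is integer (`0/1`-valued) on every variable
`P_{i,j}` mentioning an element of `X`, and equals `1/2` on every variable
`P_{i,j}` with `i ∉ X` and `j ∉ X`. -/
theorem statement_10 (n : ℕ) (X : Finset (Fin n)) (hX : (X.card : ℤ) ≤ (n : ℤ) - 3) :
    ∃ x : Fin n → Fin n → ℚ, LOPAdmissible n x ∧
      (∀ i j, i ≠ j → (i ∈ X ∨ j ∈ X) → x i j = 0 ∨ x i j = 1) ∧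
      (∀ i j, i ≠ j → i ∉ X → j ∉ X → x i j = 1/2) := by
  obtain ⟨x, hx⟩ : ∃ x : Fin n → Fin n → ℚ, x = fun i j =>
    if i ∈ X then (if j ∈ X then (if i < j then 1 else 0) else 0)
    else (if j ∈ X then 1 else 1/2) := ⟨_, rfl⟩
  have hnn : ∀ i j, 0 ≤ x i j := by
    intro i j
    rw [hx]
    dsimp only
    split_ifs <;> norm_num
  have hhalf : ∀ i j, i ∉ X → 1/2 ≤ x i j := by
    intro i j hi
    rw [hx]
    dsimp only
    rw [if_neg hi]
    split_ifs <;> norm_num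
  refine ⟨x, ⟨?_, ?_, ?_, ?_⟩, ?_, ?_⟩
  · intro i j _
    rw [hx]
    dsimp only
    split_ifs <;> norm_num
  · intro i j hij
    rw [hx]
    dsimp only
    split_ifs <;> first | (exfalso; omega) | norm_num
  · intro i j k _ _ _
    rw [hx]
    dsimp only
    split_ifs <;> first | (exfalso; omega) | norm_num
  · intro j
    have hc : 1 < (Xᶜ.erase j).card := by
      have h1 := Finset.card_compl X
      have h2 := Finset.pred_card_le_card_erase (s := Xᶜ) (a := j)
      rw [Fintype.card_fin] at h1
      omega
    obtain ⟨a, ha, b, hb, hab⟩ := Finset.one_lt_card.1 hc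
    simp only [Finset.mem_erase, Finset.mem_compl] at ha hb
    have hs : ({a, b} : Finset (Fin n)) ⊆ Finset.univ.filter (fun i => i ≠ j) := by
      intro c hc
      simp only [Finset.mem_insert, Finset.mem_singleton] at hc
      rcases hc with rfl | rfl
      · simp [ha.1]
      · simp [hb.1]
    have := Finset.sum_le_sum_of_subset_of_nonneg (f := fun i => x i j) hs
      (fun i _ _ => hnn i j)
    rw [Finset.sum_pair hab] at this
    have h1 := hhalf a j ha.2
    have h2 := hhalf b j hb.2
    linarith
  · intro i j _ h
    rw [hx]
    dsimp only
    split_ifs <;> simp_all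
  · intro i j _ hi hj
    rw [hx]
    simp [hi, hj]
end

section
/- Let n ≥ 3 and let d be an integer with d ≤ (n−3)/2. Let {l_1,r_1},…,{l_d,r_d} be pairwise disjoint pairs of distinct elements of [n], and let b ∈ {0,1}^d. Then the point x_b defined by x_b(P_{l_k,r_k}) = b_k and x_b(P_{r_k,l_k}) = 1 − b_k for each k ∈ [d], and x_b(P_{i,j}) = 1/2 for every other ordered pair (i,j) with i ≠ j, is an admissible point of LOP_n. -/
/-- let `n ≥ 3`, `d ≤ (n-3)/2`, let `{l_k, r_k}` (`k ∈ [d]`) be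
pairwise disjoint pairs of distinct elements of `[n]`, and `b ∈ {0,1}^d`.  Then
the point `x_b` with `x_b(P_{l_k, r_k}) = b_k`, `x_b(P_{r_k, l_k}) = 1 - b_k`,
and `x_b(P_{i,j}) = 1/2` for every other ordered pair `(i,j)`, `i ≠ j`, is an
admissible point of `LOP_n`. -/
theorem statement_11 (n : ℕ) (hn : 3 ≤ n) (d : ℕ) (hd : d ≤ (n - 3) / 2)
    (l r : Fin d → Fin n) (hlr : ∀ k, l k ≠ r k)
    (hdisj : ∀ k k', k ≠ k' →
      l k ≠ l k' ∧ l k ≠ r k' ∧ r k ≠ l k' ∧ r k ≠ r k')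
    (b : Fin d → ℚ) (hb : ∀ k, b k = 0 ∨ b k = 1)
    (x : Fin n → Fin n → ℚ)
    (hx1 : ∀ k, x (l k) (r k) = b k)
    (hx2 : ∀ k, x (r k) (l k) = 1 - b k)
    (hx3 : ∀ i j, i ≠ j →
      (∀ k, ¬(i = l k ∧ j = r k) ∧ ¬(i = r k ∧ j = l k)) → x i j = 1/2) :
    LOPAdmissible n x := by
  have hM : ∀ i j, i ≠ j → x i j = 1/2 ∨
      ∃ k, (i = l k ∧ j = r k) ∨ (i = r k ∧ j = l k) := by
    intro i j hij
    by_cases h : ∃ k, (i = l k ∧ j = r k) ∨ (i = r k ∧ j = l k)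
    · exact Or.inr h
    · left
      apply hx3 i j hij
      intro k
      push Not at h
      have := h k
      tauto
  have hsym : ∀ i j, i ≠ j → x i j + x j i = 1 := by
    intro i j hij
    by_cases h : ∃ k, (i = l k ∧ j = r k) ∨ (i = r k ∧ j = l k)
    · obtain ⟨k, ⟨rfl, rfl⟩ | ⟨rfl, rfl⟩⟩ := h
      · rw [hx1, hx2]; ring
      · rw [hx1, hx2]; ring
    · push Not at h
      rw [hx3 i j hij (fun k => by have := h k; tauto),
        hx3 j i hij.symm (fun k => by have := h k; tauto)]
      norm_num
  have hval : ∀ i j, i ≠ j → x i j = 0 ∨ x i j = 1/2 ∨ x i j = 1 := by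
    intro i j hij
    rcases hM i j hij with h | ⟨k, ⟨rfl, rfl⟩ | ⟨rfl, rfl⟩⟩
    · exact Or.inr (Or.inl h)
    · rw [hx1]; rcases hb k with h | h <;> simp [h]
    · rw [hx2]; rcases hb k with h | h <;> simp [h]
  have hnn : ∀ i j, i ≠ j → 0 ≤ x i j ∧ x i j ≤ 1 := by
    intro i j hij
    rcases hval i j hij with h | h | h <;> rw [h] <;> norm_num
  -- a vertex has at most one partner
  have huniq : ∀ i j k, i ≠ j → i ≠ k → j ≠ k → x i j = 1/2 ∨ x i k = 1/2 := by
    intro i j k hij hik hjk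
    rcases hM i j hij with h | ⟨s, hs⟩
    · exact Or.inl h
    rcases hM i k hik with h | ⟨t, ht⟩
    · exact Or.inr h
    exfalso
    have h1 := hlr s
    have h2 := hlr t
    by_cases hst : s = t
    · subst hst
      grind
    · have := hdisj s t hst
      grind
  refine ⟨hval, hsym, ?_, ?_⟩
  · intro i j k hij hjk hik
    have h1 := huniq i j k hij hik hjk
    have h2 := huniq j i k hij.symm hjk hik
    have h3 := huniq k i j hik.symm hjk.symm hij
    have s1 := hsym i j hij
    have s2 := hsym j k hjk
    have s3 := hsym i k hik
    have b1 := hnn i j hij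
    have b2 := hnn j k hjk
    have b3 := hnn i k hik
    rcases h1 with h1 | h1 <;> rcases h2 with h2 | h2 <;> rcases h3 with h3 | h3 <;> linarith
  · intro j
    have hnq : (3 : ℚ) ≤ n := by exact_mod_cast hn
    by_cases hp : ∃ p, p ≠ j ∧ x p j ≠ 1/2
    · obtain ⟨p, hpj, hp⟩ := hp
      have hn5 : 5 ≤ n := by
        rcases hM p j hpj with h | ⟨k, -⟩
        · exact absurd h hp
        · have := k.pos
          omega
      have hsub : (Finset.univ \ {j, p} : Finset (Fin n)) ⊆
          Finset.univ.filter (fun i => i ≠ j) := by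
        intro i hi
        simp at hi ⊢
        tauto
      have hcard : (Finset.univ \ {j, p} : Finset (Fin n)).card = n - 2 := by
        rw [Finset.card_sdiff_of_subset (Finset.subset_univ _), Finset.card_pair hpj.symm]
        simp
      calc (1 : ℚ) ≤ ((n - 2 : ℕ) : ℚ) * (1/2) := by
            have : (3 : ℚ) ≤ ((n - 2 : ℕ) : ℚ) := by
              exact_mod_cast (by omega : 3 ≤ n - 2)
            linarith
        _ = ∑ i ∈ (Finset.univ \ {j, p} : Finset (Fin n)), (1/2 : ℚ) := by
            rw [Finset.sum_const, hcard, nsmul_eq_mul]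
        _ = ∑ i ∈ (Finset.univ \ {j, p} : Finset (Fin n)), x i j := by
            apply Finset.sum_congr rfl
            intro i hi
            simp at hi
            have s1 := hsym i j hi.1
            have s2 := hsym p j hpj
            rcases huniq j i p (Ne.symm hi.1) hpj.symm hi.2 with h | h
            · linarith
            · exact absurd (by linarith) hp
        _ ≤ _ := by
            apply Finset.sum_le_sum_of_subset_of_nonneg hsub
            intro i hi _
            simp at hi
            exact (hnn i j hi).1
    · push Not at hp
      have hcard : (Finset.univ.filter (fun i => i ≠ j) : Finset (Fin n)).card = n - 1 := by
        rw [Finset.filter_ne', Finset.card_erase_of_mem (Finset.mem_univ _)]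
        simp
      rw [Finset.sum_congr rfl (fun i hi => hp i (Finset.mem_filter.1 hi).2),
        Finset.sum_const, hcard, nsmul_eq_mul]
      have : (2 : ℚ) ≤ ((n - 1 : ℕ) : ℚ) := by
        exact_mod_cast (by omega : 2 ≤ n - 1)
      linarith
end
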